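/- arXiv:2508.10087 — 7 statements merged into one kernel-verified Lean document; each statement's English description precedes it below -/
import Mathlib

section
/- Let a : ℕ → ℕ be a nondecreasing sequence of positive integers (a₀ ≥ 1 and a_n ≤ a_{n+1} for all n) such that (log a_n)/√n converges to a finite limit L ≥ 0 as n → ∞. Let b : ℕ → ℤ be a sequence for which there is a polynomial P with nonnegative real coefficients such that |b_n| ≤ P(n) for all n. Define the convolution c_n = Σ_{k=0}^{n} a_k · b_{n−k}. Then limsup_{n→∞} (log |c_n|)² / n ≤ L² = lim_{n→∞} (log a_n)² / n. (Terms with c_n = 0 are interpreted via the convention log 0 = 0.) Equivalently, with c_eff of a coefficient sequence (x_n) defined as (3/(2π²))·limsup_{n→∞} (log|x_n|)²/n, one has c_eff of the product series P(q)Q(q) is at most c_eff of P(q). -/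
open Filter

/-- If `a` is a nondecreasing sequence of positive integers with
`log (a n) / √n → L ≥ 0`, and `b` is an integer sequence bounded in absolute value by a
polynomial with nonnegative coefficients, then the convolution
`c n = ∑_{k=0}^n a k * b (n-k)` satisfies
`limsup (log |c n|)² / n ≤ L² = lim (log a n)² / n`. -/
theorem stmt0 (a : ℕ → ℕ) (b : ℕ → ℤ) (L : ℝ)
    (ha1 : 1 ≤ a 0) (hmono : ∀ n, a n ≤ a (n + 1)) (hL : 0 ≤ L)
    (hlim : Tendsto (fun n : ℕ => Real.log (a n) / Real.sqrt n) atTop (nhds L))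
    (P : Polynomial ℝ) (hP : ∀ i, 0 ≤ P.coeff i)
    (hb : ∀ n : ℕ, |(b n : ℝ)| ≤ P.eval (n : ℝ))
    (c : ℕ → ℤ)
    (hc : ∀ n, c n = ∑ k ∈ Finset.range (n + 1), (a k : ℤ) * b (n - k)) :
    limsup (fun n : ℕ => (Real.log |(c n : ℝ)|) ^ 2 / n) atTop ≤ L ^ 2 ∧
      Tendsto (fun n : ℕ => (Real.log (a n)) ^ 2 / n) atTop (nhds (L ^ 2)) := by
  have hmon : Monotone a := monotone_nat_of_le_succ hmono
  have hapos : ∀ n, (1 : ℝ) ≤ a n := fun n => by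
    exact_mod_cast ha1.trans (hmon (Nat.zero_le n))
  have hsq : Tendsto (fun n : ℕ => (Real.log (a n)) ^ 2 / n) atTop (nhds (L ^ 2)) := by
    refine (hlim.pow 2).congr fun n => ?_
    rw [div_pow, Real.sq_sqrt (Nat.cast_nonneg n)]
  refine ⟨?_, hsq⟩
  set d := P.natDegree with hd
  have hP1 : 0 ≤ P.eval 1 := by
    rw [Polynomial.eval_eq_sum_range]
    exact Finset.sum_nonneg fun i _ => by simpa using hP i
  set M : ℝ := 2 * (P.eval 1 + 1) with hM
  have hM1 : 1 ≤ M := by linarith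
  have hPb : ∀ m n : ℕ, 1 ≤ n → m ≤ n → P.eval (m : ℝ) ≤ (P.eval 1 + 1) * (n : ℝ) ^ d := by
    intro m n hn hmn
    have hn' : (1 : ℝ) ≤ n := by exact_mod_cast hn
    have hmn' : (m : ℝ) ≤ n := by exact_mod_cast hmn
    have h1 : P.eval (m : ℝ) ≤ P.eval 1 * (n : ℝ) ^ d := by
      rw [Polynomial.eval_eq_sum_range, Polynomial.eval_eq_sum_range, Finset.sum_mul]
      refine Finset.sum_le_sum fun i hi => ?_
      have hid : i ≤ d := by
        have := Finset.mem_range.1 hi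
        omega
      rw [one_pow, mul_one]
      refine mul_le_mul_of_nonneg_left ?_ (hP i)
      exact (pow_le_pow_left₀ (Nat.cast_nonneg m) hmn' i).trans (pow_le_pow_right₀ hn' hid)
    have h2 : (0 : ℝ) ≤ (n : ℝ) ^ d := by positivity
    linarith
  have hcb : ∀ n : ℕ, 1 ≤ n → |(c n : ℝ)| ≤ a n * (M * (n : ℝ) ^ (d + 1)) := by
    intro n hn
    have hn' : (1 : ℝ) ≤ n := by exact_mod_cast hn
    rw [hc n]
    push_cast
    refine (Finset.abs_sum_le_sum_abs _ _).trans ?_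
    have hterm : ∀ k ∈ Finset.range (n + 1), |(a k : ℝ) * (b (n - k) : ℝ)| ≤
        a n * ((P.eval 1 + 1) * (n : ℝ) ^ d) := by
      intro k hk
      have hk' : k ≤ n := by
        have := Finset.mem_range.1 hk
        omega
      rw [abs_mul, Nat.abs_cast]
      exact mul_le_mul (by exact_mod_cast hmon hk')
        ((hb (n - k)).trans (hPb _ n hn (Nat.sub_le n k))) (abs_nonneg _) (Nat.cast_nonneg _)
    refine (Finset.sum_le_sum hterm).trans ?_
    rw [Finset.sum_const, Finset.card_range, nsmul_eq_mul]
    push_cast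
    have h0 : 0 ≤ (a n : ℝ) * ((P.eval 1 + 1) * (n : ℝ) ^ d) := by positivity
    have h1 : ((n : ℝ) + 1) ≤ 2 * n := by linarith
    calc _ ≤ (2 * (n : ℝ)) * ((a n : ℝ) * ((P.eval 1 + 1) * (n : ℝ) ^ d)) :=
          mul_le_mul_of_nonneg_right h1 h0
      _ = _ := by rw [hM]; ring
  have hlogc : ∀ n, 0 ≤ Real.log |(c n : ℝ)| := by
    intro n
    have : |(c n : ℝ)| = ((c n).natAbs : ℝ) := by
      rw [Nat.cast_natAbs, Int.cast_abs]
    rw [this]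
    exact Real.log_natCast_nonneg _
  have hlogb : ∀ n : ℕ, 1 ≤ n → Real.log |(c n : ℝ)| ≤
      Real.log (a n) + (Real.log M + (d + 1 : ℕ) * Real.log n) := by
    intro n hn
    have hn' : (1 : ℝ) ≤ n := by exact_mod_cast hn
    have ha := hapos n
    have hexp : Real.log (a n * (M * (n : ℝ) ^ (d + 1))) =
        Real.log (a n) + (Real.log M + (d + 1 : ℕ) * Real.log n) := by
      rw [Real.log_mul (by positivity) (by positivity),
        Real.log_mul (by positivity) (by positivity), Real.log_pow]
    by_cases h0 : c n = 0
    · rw [h0]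
      have := Real.log_nonneg ha
      have := Real.log_nonneg hM1
      have := Real.log_nonneg hn'
      simp only [Int.cast_zero, abs_zero, Real.log_zero]
      positivity
    · rw [← hexp]
      exact Real.log_le_log (by simpa using h0) (hcb n hn)
  have hs : Tendsto (fun n : ℕ => Real.sqrt (n : ℝ)) atTop atTop :=
    Real.tendsto_sqrt_atTop.comp tendsto_natCast_atTop_atTop
  have hl : Tendsto (fun n : ℕ => Real.log n / Real.sqrt n) atTop (nhds 0) := by
    have h := (isLittleO_log_rpow_atTop (r := 1 / 2) (by norm_num)).tendsto_div_nhds_zero.comp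
      (tendsto_natCast_atTop_atTop (R := ℝ))
    refine h.congr fun n => ?_
    simp [Real.sqrt_eq_rpow]
  have hV : Tendsto (fun n : ℕ =>
      (Real.log (a n) + (Real.log M + (d + 1 : ℕ) * Real.log n)) ^ 2 / n) atTop
      (nhds (L ^ 2)) := by
    have h := (hlim.add ((hs.const_div_atTop (Real.log M)).add
      (hl.const_mul ((d + 1 : ℕ) : ℝ)))).pow 2
    rw [mul_zero, add_zero, add_zero] at h
    refine h.congr fun n => ?_
    rw [← mul_div_assoc, ← add_div, ← add_div, div_pow, Real.sq_sqrt (Nat.cast_nonneg n)]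
  rw [← hV.limsup_eq]
  refine limsup_le_limsup ?_ ?_ hV.isBoundedUnder_le
  · filter_upwards [eventually_ge_atTop 1] with n hn
    exact div_le_div_of_nonneg_right (pow_le_pow_left₀ (hlogc n) (hlogb n hn) 2)
      (Nat.cast_nonneg n)
  · exact IsCoboundedUnder.of_frequently_ge (a := 0)
      (Frequently.of_forall fun n => by positivity)
end

section
/- Let p(n) denote the number of partitions of the natural number n. Then (log p(n))²/n converges to 2π²/3 as n → ∞. Equivalently, the effective central charge of the q-series 1/(q;q)_∞ = Σ_{n≥0} p(n) q^n equals 1, where c_eff := (3/(2π²))·limsup_{n→∞} (log p(n))²/n. -/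
open Filter

namespace PartAsym
open Finset

/-- number of partitions of n with parts at most N -/
def r (N n : ℕ) : ℕ := (Nat.Partition.restricted n (· ≤ N)).card

/-- partition numbers -/
def p (n : ℕ) : ℕ := Fintype.card (Nat.Partition n)

lemma r_le (N n : ℕ) : r N n ≤ p n := by
  unfold r p
  exact Finset.card_le_univ _

lemma r_eq {N n : ℕ} (h : n ≤ N) : r N n = p n := by
  unfold r p
  rw [← Finset.card_univ]
  congr 1
  rw [Nat.Partition.restricted, Finset.filter_true_of_mem]
  intro x _ i hi
  exact (x.parts_sum ▸ Multiset.le_sum_of_mem hi : i ≤ n).trans h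

open PowerSeries PowerSeries.WithPiTopology in
lemma mk_r (N : ℕ) : (PowerSeries.mk fun n => (r N n : ℝ)) =
    ∏ i ∈ range N, ∑' j : ℕ, (X : ℝ⟦X⟧) ^ ((i + 1) * j) := by
  have h := Nat.Partition.hasProd_powerSeriesMk_card_restricted ℝ (· ≤ N)
  have h2 := hasProd_prod_of_ne_finset_one (s := range N)
    (f := fun i ↦ if i + 1 ≤ N then ∑' j : ℕ, (X : ℝ⟦X⟧) ^ ((i + 1) * j) else 1)
    (L := SummationFilter.unconditional ℕ)
    (by intro b hb; simp at hb; rw [if_neg (by omega)])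
  have h3 := h.unique h2
  unfold r
  rw [h3]
  refine Finset.prod_congr rfl fun i hi => ?_
  simp at hi
  rw [if_pos (by omega)]

open PowerSeries PowerSeries.WithPiTopology in
lemma mk_r_mul (N : ℕ) : (PowerSeries.mk fun n => (r (N+1) n : ℝ)) * (1 - X ^ (N+1)) =
    (PowerSeries.mk fun n => (r N n : ℝ)) := by
  rw [mk_r, mk_r, prod_range_succ, mul_assoc]
  simp_rw [pow_mul]
  rw [tsum_pow_mul_one_sub_of_constantCoeff_eq_zero (by simp), mul_one]

lemma r_rec (N n : ℕ) : (r (N+1) n : ℝ) =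
    r N n + if N + 1 ≤ n then (r (N+1) (n - (N+1)) : ℝ) else 0 := by
  have h := congrArg (PowerSeries.coeff n) (mk_r_mul N)
  rw [mul_sub, mul_one, map_sub, PowerSeries.coeff_mul_X_pow'] at h
  simp only [PowerSeries.coeff_mk] at h
  linarith

lemma r_zero (n : ℕ) : (r 0 n : ℝ) = if n = 0 then 1 else 0 := by
  have h := congrArg (PowerSeries.coeff n) (mk_r 0)
  simpa [PowerSeries.coeff_one] using h

lemma hasSum_r {x : ℝ} (h0 : 0 ≤ x) (h1 : x < 1) (N : ℕ) :
    HasSum (fun n => (r N n : ℝ) * x ^ n) (∏ i ∈ range N, (1 - x ^ (i+1))⁻¹) := by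
  induction N with
  | zero =>
    simp only [r_zero]
    convert hasSum_single (f := fun n => (if n = 0 then (1:ℝ) else 0) * x ^ n) 0 ?_ using 1
    · simp
    · intro b hb; simp [hb]
  | succ N ih =>
    have hx : x ^ (N+1) < 1 := pow_lt_one₀ h0 h1 (by omega)
    have hrec : ∀ n, (r (N+1) (n + (N+1)) : ℝ) * x ^ (n + (N+1)) =
        r N (n + (N+1)) * x ^ (n + (N+1)) + x ^ (N+1) * (r (N+1) n * x ^ n) := by
      intro n
      rw [r_rec N (n + (N+1)), if_pos (by omega), Nat.add_sub_cancel]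
      ring
    have hlow : ∀ n ∈ range (N+1), (r (N+1) n : ℝ) * x ^ n = r N n * x ^ n := by
      intro n hn
      simp at hn
      rw [r_rec N n, if_neg (by omega), add_zero]
    have hnn : ∀ K n, 0 ≤ (r K n : ℝ) * x ^ n := fun K n => by positivity
    have hs : Summable (fun n => (r (N+1) n : ℝ) * x ^ n) := by
      refine summable_of_sum_range_le (c := (∏ i ∈ range N, (1 - x ^ (i+1))⁻¹) / (1 - x ^ (N+1)))
        (hnn _) ?_
      intro M
      rw [le_div_iff₀ (by linarith)]
      have e1 : ∑ n ∈ range M, (r (N+1) n : ℝ) * x ^ n ≤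
          ∑ n ∈ range (N + 1 + M), (r (N+1) n : ℝ) * x ^ n :=
        sum_le_sum_of_subset_of_nonneg (by intro i; simp; omega) (fun i _ _ => hnn _ i)
      rw [sum_range_add, sum_congr rfl hlow] at e1
      have e2 := sum_le_hasSum (range (N+1+M)) (fun i _ => hnn N i) ih
      rw [sum_range_add] at e2
      simp_rw [add_comm (N+1) _, hrec, sum_add_distrib, ← mul_sum] at e1
      simp_rw [add_comm (N+1) _] at e2
      linarith
    have e1 := hs.sum_add_tsum_nat_add (N+1)
    have e2 := ih.summable.sum_add_tsum_nat_add (N+1)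
    simp_rw [hrec] at e1
    rw [sum_congr rfl hlow, Summable.tsum_add ((summable_nat_add_iff (N+1)).2 ih.summable)
      (hs.mul_left _), tsum_mul_left] at e1
    rw [ih.tsum_eq] at e2
    have e3 : ∑' n, (r (N+1) n : ℝ) * x ^ n = ∏ i ∈ range (N+1), (1 - x ^ (i+1))⁻¹ := by
      rw [prod_range_succ, ← div_eq_mul_inv, eq_div_iff (by linarith)]
      linarith
    rw [← e3]
    exact hs.hasSum

lemma p_mono : Monotone p := by
  refine monotone_nat_of_le_succ fun n => ?_
  unfold p
  refine Fintype.card_le_of_injective (fun q : Nat.Partition n =>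
    (⟨1 ::ₘ q.parts, ?_, ?_⟩ : Nat.Partition (n+1))) ?_
  · intro i hi
    rcases Multiset.mem_cons.1 hi with h | h
    · omega
    · exact q.parts_pos h
  · simp [q.parts_sum, add_comm]
  · intro q1 q2 h
    simp at h
    exact Nat.Partition.ext h

lemma p_pos (n : ℕ) : 1 ≤ p n := by
  have h := p_mono (Nat.zero_le n)
  have : p 0 = 1 := by unfold p; simp
  omega

lemma hasSum_zeta : HasSum (fun m : ℕ => 1 / ((m:ℝ)+1)^2) (Real.pi^2/6) := by
  have h := (hasSum_nat_add_iff' (f := fun n : ℕ => 1 / (n:ℝ)^2) 1).2 hasSum_zeta_two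
  simpa using h

lemma hasSum_geo {t : ℝ} (ht : 0 < t) (m : ℕ) :
    HasSum (fun i : ℕ => (Real.exp (-t) ^ (i+1)) ^ (m+1) / ((m:ℝ)+1))
      (Real.exp (-t)^(m+1) / (1 - Real.exp (-t)^(m+1)) / ((m:ℝ)+1)) := by
  have hx : Real.exp (-t) < 1 := by simpa using ht
  have h := (hasSum_geometric_of_lt_one (by positivity)
    (pow_lt_one₀ (Real.exp_pos _).le hx (Nat.succ_ne_zero m))).mul_left (Real.exp (-t)^(m+1))
  have h2 := h.div_const ((m:ℝ)+1)
  rw [← div_eq_mul_inv] at h2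
  have e : (fun i : ℕ => (Real.exp (-t) ^ (i+1)) ^ (m+1) / ((m:ℝ)+1)) =
      fun i : ℕ => Real.exp (-t)^(m+1) * (Real.exp (-t) ^ (m+1)) ^ i / ((m:ℝ)+1) := by
    funext i
    rw [← pow_mul, ← pow_mul, ← pow_add]
    congr 2; ring
  rw [e]
  exact h2

lemma geo_bounds {t : ℝ} (ht : 0 < t) (m : ℕ) :
    Real.exp (-t)^(m+1) * (1 / ((m:ℝ)+1)^2) / t ≤
      Real.exp (-t)^(m+1) / (1 - Real.exp (-t)^(m+1)) / ((m:ℝ)+1) ∧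
    Real.exp (-t)^(m+1) / (1 - Real.exp (-t)^(m+1)) / ((m:ℝ)+1) ≤ (1 / ((m:ℝ)+1)^2) / t := by
  have hm : (0:ℝ) < m + 1 := by positivity
  have e : Real.exp (-t)^(m+1) = Real.exp (-((m+1) * t)) := by
    rw [← Real.exp_nat_mul]; push_cast; ring_nf
  rw [e]
  set y := ((m:ℝ)+1) * t with hy
  have hy0 : 0 < y := by positivity
  have h1 : 0 < 1 - Real.exp (-y) := by
    have : Real.exp (-y) < 1 := by simpa using hy0
    linarith
  have h2 : 1 - Real.exp (-y) ≤ y := by have := Real.add_one_le_exp (-y); linarith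
  have h3 : Real.exp (-y) / (1 - Real.exp (-y)) ≤ 1 / y := by
    rw [div_le_div_iff₀ h1 hy0]
    have := Real.add_one_le_exp y
    have e2 : Real.exp (-y) * Real.exp y = 1 := by rw [← Real.exp_add]; simp
    nlinarith [Real.exp_pos (-y)]
  have h4 : Real.exp (-y) / y ≤ Real.exp (-y) / (1 - Real.exp (-y)) := by gcongr
  constructor
  · calc _ = Real.exp (-y) / y / ((m:ℝ)+1) := by rw [hy]; field_simp
      _ ≤ _ := by gcongr
  · calc _ ≤ 1 / y / ((m:ℝ)+1) := by gcongr
      _ = _ := by rw [hy]; field_simp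

lemma log_prod {t : ℝ} (ht : 0 < t) (N : ℕ) :
    (∏ i ∈ range N, (1 - Real.exp (-t) ^ (i+1))⁻¹) =
      Real.exp (∑ i ∈ range N, - Real.log (1 - Real.exp (-t) ^ (i+1))) := by
  rw [Real.exp_sum]
  refine prod_congr rfl fun i _ => ?_
  have hx : Real.exp (-t) ^ (i+1) < 1 :=
    pow_lt_one₀ (Real.exp_pos _).le (by simpa using ht) (by omega)
  rw [Real.exp_neg (Real.log _), Real.exp_log (by linarith)]

lemma hasSum_log {t : ℝ} (ht : 0 < t) (i : ℕ) :
    HasSum (fun m : ℕ => (Real.exp (-t) ^ (i+1)) ^ (m+1) / ((m:ℝ)+1))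
      (- Real.log (1 - Real.exp (-t) ^ (i+1))) := by
  have hx : Real.exp (-t) ^ (i+1) < 1 :=
    pow_lt_one₀ (Real.exp_pos _).le (by simpa using ht) (by omega)
  exact Real.hasSum_pow_div_log_of_abs_lt_one
    (by rw [abs_of_nonneg (by positivity)]; exact hx)

lemma prod_le {t : ℝ} (ht : 0 < t) (N : ℕ) :
    (∏ i ∈ range N, (1 - Real.exp (-t) ^ (i+1))⁻¹) ≤ Real.exp (Real.pi^2/6/t) := by
  rw [log_prod ht, Real.exp_le_exp]
  have h := hasSum_sum (s := range N) (fun i _ => hasSum_log ht i)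
  refine hasSum_le (fun m => ?_) h (hasSum_zeta.div_const t)
  refine le_trans ?_ (geo_bounds ht m).2
  exact sum_le_hasSum _ (fun i _ => by positivity) (hasSum_geo ht m)

/-- generating function -/
noncomputable def P (t : ℝ) : ℝ := ∑' n, (p n : ℝ) * Real.exp (-t) ^ n

lemma sum_p_le {t : ℝ} (ht : 0 < t) (M : ℕ) :
    ∑ n ∈ range M, (p n : ℝ) * Real.exp (-t) ^ n ≤ Real.exp (Real.pi^2/6/t) := by
  refine le_trans ?_ (prod_le ht M)
  rw [sum_congr rfl (g := fun n => (r M n : ℝ) * Real.exp (-t) ^ n)]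
  · exact sum_le_hasSum _ (fun i _ => by positivity)
      (hasSum_r (Real.exp_pos _).le (by simpa using ht) M)
  · intro n hn
    simp at hn
    rw [r_eq (by omega)]

lemma summable_p {t : ℝ} (ht : 0 < t) : Summable fun n => (p n : ℝ) * Real.exp (-t) ^ n :=
  summable_of_sum_range_le (fun n => by positivity) (sum_p_le ht)

lemma P_le {t : ℝ} (ht : 0 < t) : P t ≤ Real.exp (Real.pi^2/6/t) :=
  Real.tsum_le_of_sum_range_le (fun n => by positivity) (sum_p_le ht)

lemma prod_le_P {t : ℝ} (ht : 0 < t) (N : ℕ) :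
    (∏ i ∈ range N, (1 - Real.exp (-t) ^ (i+1))⁻¹) ≤ P t := by
  refine hasSum_le (fun n => ?_) (hasSum_r (Real.exp_pos _).le (by simpa using ht) N)
    (summable_p ht).hasSum
  have : (r N n : ℝ) ≤ p n := by exact_mod_cast r_le N n
  gcongr

lemma P_ge {t : ℝ} (ht : 0 < t) (K : ℕ) :
    Real.exp (∑ m ∈ range K, Real.exp (-t)^(m+1) * (1 / ((m:ℝ)+1)^2) / t) ≤ P t := by
  have hP : 0 < P t := by
    have := prod_le_P ht 0
    simp at this; linarith
  rw [← Real.le_log_iff_exp_le hP]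
  refine le_trans (sum_le_sum fun m _ => (geo_bounds ht m).1) ?_
  have h := (hasSum_sum (s := range K) (fun m _ => hasSum_geo ht m)).tendsto_sum_nat
  refine le_of_tendsto' h fun N => ?_
  have h2 := prod_le_P ht N
  rw [log_prod ht, ← Real.le_log_iff_exp_le hP] at h2
  refine le_trans (sum_le_sum fun i _ => ?_) h2
  exact sum_le_hasSum _ (fun i _ => by positivity) (hasSum_log ht i)

lemma P_lower {ε : ℝ} (hε : 0 < ε) :
    ∀ᶠ t in nhdsWithin 0 (Set.Ioi 0), Real.exp ((Real.pi^2/6 - ε)/t) ≤ P t := by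
  have h1 := (hasSum_zeta.tendsto_sum_nat).eventually (lt_mem_nhds (sub_lt_self _ hε))
  obtain ⟨K, hK⟩ := h1.exists
  have hc : Continuous fun t : ℝ => ∑ m ∈ range K, Real.exp (-t)^(m+1) * (1 / ((m:ℝ)+1)^2) := by
    fun_prop
  have h2 := (hc.tendsto 0).eventually (lt_mem_nhds (a := Real.pi^2/6 - ε) (by simpa using hK))
  filter_upwards [h2.filter_mono nhdsWithin_le_nhds, self_mem_nhdsWithin] with t h ht
  refine le_trans ?_ (P_ge ht K)
  rw [← sum_div, Real.exp_le_exp]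
  have ht : 0 < t := ht
  gcongr

lemma log_p_le (n : ℕ) {t : ℝ} (ht : 0 < t) :
    Real.log (p n) ≤ n * t + Real.pi^2/6/t := by
  have hp : (0:ℝ) < p n := by exact_mod_cast p_pos n
  rw [Real.log_le_iff_le_exp hp, Real.exp_add]
  have h := ((summable_p ht).le_tsum n (fun i _ => by positivity)).trans (P_le ht)
  rw [← Real.exp_nat_mul, mul_neg, Real.exp_neg, ← div_eq_mul_inv,
    div_le_iff₀ (Real.exp_pos _)] at h
  linarith

lemma key {t s s' L : ℝ} (n : ℕ) (hs : 0 < s) (hst : s ≤ t) (hs' : t ≤ s') :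
    P t ≤ Real.exp (-(n * (t - s))) * P s + Real.exp (L * (s' - t)) * P s' +
      n * (p n * Real.exp (-(L * t))) := by
  have ht : 0 < t := by linarith
  have hs'0 : 0 < s' := by linarith
  have h3 : HasSum (fun k : ℕ => if k < n then (p n * Real.exp (-(L * t)) : ℝ) else 0)
      (n * (p n * Real.exp (-(L * t)))) := by
    convert hasSum_sum_of_ne_finset_zero (s := range n)
      (f := fun k : ℕ => if k < n then (p n * Real.exp (-(L * t)) : ℝ) else 0)
      (L := SummationFilter.unconditional ℕ) ?_ using 1
    · rw [sum_congr rfl (g := fun _ => (p n * Real.exp (-(L * t)) : ℝ))]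
      · simp
      · intro k hk; simp at hk; simp [hk]
    · intro k hk; simp at hk; simp [hk]
  refine hasSum_le (fun k => ?_) (summable_p ht).hasSum
    ((((summable_p hs).hasSum.mul_left _).add ((summable_p hs'0).hasSum.mul_left _)).add h3)
  have hite : 0 ≤ if k < n then (p n * Real.exp (-(L * t)) : ℝ) else 0 := by
    split_ifs <;> positivity
  have hA : 0 ≤ Real.exp (-(n * (t - s))) * (p k * Real.exp (-s) ^ k) := by positivity
  have hB : 0 ≤ Real.exp (L * (s' - t)) * (p k * Real.exp (-s') ^ k) := by positivity
  by_cases hkn : n ≤ k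
  · have hk : (n:ℝ) ≤ k := by exact_mod_cast hkn
    have : (p k : ℝ) * Real.exp (-t) ^ k ≤
        Real.exp (-(n * (t - s))) * (p k * Real.exp (-s) ^ k) := by
      rw [mul_left_comm, ← Real.exp_nat_mul, ← Real.exp_nat_mul, ← Real.exp_add]
      gcongr
      nlinarith
    linarith
  · by_cases hkL : (k:ℝ) ≤ L
    · have : (p k : ℝ) * Real.exp (-t) ^ k ≤
          Real.exp (L * (s' - t)) * (p k * Real.exp (-s') ^ k) := by
        rw [mul_left_comm, ← Real.exp_nat_mul, ← Real.exp_nat_mul, ← Real.exp_add]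
        gcongr
        nlinarith
      linarith
    · have : (p k : ℝ) * Real.exp (-t) ^ k ≤
          if k < n then (p n * Real.exp (-(L * t)) : ℝ) else 0 := by
        rw [if_pos (by omega), ← Real.exp_nat_mul]
        have : (p k : ℝ) ≤ p n := by exact_mod_cast p_mono (by omega : k ≤ n)
        gcongr
        nlinarith
      linarith

lemma log_p_ge {δ : ℝ} (hδ : 0 < δ) (hδa : δ < Real.pi^2/6) :
    ∀ᶠ n : ℕ in atTop, (2 * (Real.pi^2/6) - 2 * δ) / Real.sqrt (Real.pi^2/6 + δ) * Real.sqrt n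
      - Real.log (2 * n) ≤ Real.log (p n) := by
  set a := Real.pi^2/6 with ha
  have ha0 : 0 < a := by positivity
  obtain ⟨η, hη⟩ : ∃ η, η = δ / (4 * a) := ⟨_, rfl⟩
  have hη0 : 0 < η := by rw [hη]; positivity
  have hη1 : η < 1/4 := by
    rw [hη, div_lt_iff₀ (by positivity)]; linarith
  have hηa : 4 * a * η = δ := by rw [hη]; field_simp
  obtain ⟨κ, hκ⟩ : ∃ κ, κ = δ * η / 2 := ⟨_, rfl⟩
  have hκ0 : 0 < κ := by rw [hκ]; positivity
  have hκδ : κ ≤ δ := by rw [hκ]; nlinarith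
  have b1 : -((a+δ)*η) + a/(1-η) ≤ a - κ := by
    have : a/(1-η) ≤ a * (1 + η + 2*η^2) := by
      rw [div_le_iff₀ (by linarith)]
      have : 1 ≤ (1 + η + 2*η^2) * (1 - η) := by nlinarith [sq_nonneg η, mul_pos hη0 hη0]
      nlinarith
    rw [hκ]; nlinarith
  have b2 : (a-δ)*η + a/(1+η) ≤ a - κ := by
    have : a/(1+η) ≤ a * (1 - η + η^2) := by
      rw [div_le_iff₀ (by linarith)]
      have : 1 ≤ (1 - η + η^2) * (1 + η) := by nlinarith [pow_pos hη0 3]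
      nlinarith
    rw [hκ]; nlinarith
  -- u = 1/t → ∞
  have hu : Tendsto (fun n : ℕ => Real.sqrt n / Real.sqrt (a + δ)) atTop atTop :=
    (Real.tendsto_sqrt_atTop.comp tendsto_natCast_atTop_atTop).atTop_div_const (by positivity)
  have ht := (tendsto_inv_atTop_nhdsGT_zero.comp hu).eventually (P_lower (half_pos hκ0))
  have hbig := hu.eventually (eventually_ge_atTop (Real.log 4 / (κ/2)))
  filter_upwards [ht, hbig, hu.eventually_gt_atTop 0, eventually_gt_atTop 0] with n h1 h2 hu0 hn
  have hn0 : (0:ℝ) < n := by exact_mod_cast hn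
  simp only [Function.comp] at h1
  obtain ⟨u, hu⟩ : ∃ u, u = Real.sqrt n / Real.sqrt (a + δ) := ⟨_, rfl⟩
  have hnu : (n:ℝ) = (a+δ) * u^2 := by
    rw [hu, div_pow, Real.sq_sqrt hn0.le, Real.sq_sqrt (by positivity)]; field_simp
  have hgoal : (2 * a - 2 * δ) / Real.sqrt (a + δ) * Real.sqrt n = (2*a - 2*δ) * u := by
    rw [hu]; ring
  rw [hgoal]
  rw [← hu] at h1 h2 hu0
  have hp : (0:ℝ) < p n := by exact_mod_cast p_pos n
  have hk := key (t := u⁻¹) (s := (1-η)*u⁻¹) (s' := (1+η)*u⁻¹) (L := (a-δ)*u^2) n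
    (mul_pos (by linarith) (inv_pos.2 hu0)) (by nlinarith [inv_pos.2 hu0])
    (by nlinarith [inv_pos.2 hu0])
  have c1 : Real.exp (-(n * (u⁻¹ - (1-η)*u⁻¹))) * P ((1-η)*u⁻¹) ≤ Real.exp ((a-κ)*u) := by
    refine (mul_le_mul_of_nonneg_left (P_le (mul_pos (by linarith) (inv_pos.2 hu0)))
      (Real.exp_pos _).le).trans ?_
    rw [← Real.exp_add, Real.exp_le_exp, ← ha]
    calc _ = (-((a+δ)*η) + a/(1-η)) * u := by
          have : 1 - η ≠ 0 := by linarith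
          rw [hnu]; field_simp; ring
      _ ≤ _ := by gcongr
  have c2 : Real.exp ((a-δ)*u^2 * ((1+η)*u⁻¹ - u⁻¹)) * P ((1+η)*u⁻¹) ≤ Real.exp ((a-κ)*u) := by
    refine (mul_le_mul_of_nonneg_left (P_le (mul_pos (by linarith) (inv_pos.2 hu0)))
      (Real.exp_pos _).le).trans ?_
    rw [← Real.exp_add, Real.exp_le_exp, ← ha]
    calc _ = ((a-δ)*η + a/(1+η)) * u := by
          have : 1 + η ≠ 0 := by linarith
          field_simp; ring
      _ ≤ _ := by gcongr
  have c3 : (a - δ) * u^2 * u⁻¹ = (a-δ) * u := by field_simp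
  rw [c3] at hk
  have c4 : (a - κ/2) / u⁻¹ = (a - κ/2) * u := by field_simp
  rw [c4] at h1
  have c5 : 4 * Real.exp ((a-κ)*u) ≤ Real.exp ((a-κ/2)*u) := by
    rw [div_le_iff₀ (by positivity)] at h2
    have : (4:ℝ) = Real.exp (Real.log 4) := by rw [Real.exp_log (by norm_num)]
    rw [this, ← Real.exp_add, Real.exp_le_exp]
    linarith
  have c6 : Real.exp ((a-κ/2)*u) ≤ 2 * n * (p n * Real.exp (-((a-δ)*u))) := by linarith
  have c7 : Real.exp ((2*a - 2*δ)*u) ≤ 2 * n * p n := by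
    have e : Real.exp ((a-κ/2)*u) * Real.exp ((a-δ)*u) ≤ 2 * n * p n := by
      rw [Real.exp_neg] at c6
      calc _ ≤ 2 * n * (p n * (Real.exp ((a-δ)*u))⁻¹) * Real.exp ((a-δ)*u) := by gcongr
        _ = _ := by field_simp
    refine le_trans ?_ e
    rw [← Real.exp_add, Real.exp_le_exp]
    nlinarith
  have c8 := (Real.le_log_iff_exp_le (by positivity)).2 c7
  rw [Real.log_mul (by positivity) (by positivity)] at c8
  linarith

lemma tendsto_log_div : Tendsto (fun n : ℕ => Real.log (2 * n) / Real.sqrt n) atTop (nhds 0) := by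
  have h : Tendsto (fun x : ℝ => Real.log x / x ^ (1/2 : ℝ)) atTop (nhds 0) :=
    (isLittleO_log_rpow_atTop (by norm_num)).tendsto_div_nhds_zero
  have h2 : Tendsto (fun n : ℕ => 2 * (n:ℝ)) atTop atTop :=
    tendsto_natCast_atTop_atTop.const_mul_atTop (by norm_num)
  have h3 := (h.comp h2).const_mul (Real.sqrt 2)
  rw [mul_zero] at h3
  refine h3.congr fun n => ?_
  simp only [Function.comp]
  rw [← Real.sqrt_eq_rpow, Real.sqrt_mul (by norm_num)]
  field_simp

lemma tendsto_main : Tendsto (fun n : ℕ => Real.log (p n) / Real.sqrt n) atTop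
    (nhds (2 * Real.sqrt (Real.pi^2/6))) := by
  have ha0 : 0 < Real.pi^2/6 := by positivity
  refine tendsto_order.2 ⟨fun b hb => ?_, fun b hb => ?_⟩
  · have hc : ContinuousAt (fun δ : ℝ => (2 * (Real.pi^2/6) - 2 * δ) /
        Real.sqrt (Real.pi^2/6 + δ)) 0 := by
      refine ContinuousAt.div (by fun_prop) (by fun_prop) ?_
      rw [add_zero]; positivity
    have h0 : (2 * (Real.pi^2/6) - 2 * 0) / Real.sqrt (Real.pi^2/6 + 0)
        = 2 * Real.sqrt (Real.pi^2/6) := by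
      rw [add_zero, mul_zero, sub_zero, div_eq_iff (by positivity), mul_assoc,
        Real.mul_self_sqrt ha0.le]
    have h1 := hc.tendsto.eventually (lt_mem_nhds (a := b) (by rw [h0]; exact hb))
    have h2 : ∀ᶠ δ in nhdsWithin (0:ℝ) (Set.Ioi 0), δ < Real.pi^2/6 :=
      (gt_mem_nhds ha0).filter_mono nhdsWithin_le_nhds
    obtain ⟨δ, ⟨h3, h4⟩, h5⟩ := ((h1.filter_mono nhdsWithin_le_nhds).and h2 |>.and
      (self_mem_nhdsWithin (a := (0:ℝ)) (s := Set.Ioi 0))).exists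
    have h6 := tendsto_log_div.eventually (gt_mem_nhds (sub_pos.2 h3))
    filter_upwards [log_p_ge h5 h4, h6, eventually_gt_atTop 0] with n h7 h8 hn
    have hs : 0 < Real.sqrt n := Real.sqrt_pos.2 (by exact_mod_cast hn)
    rw [div_lt_iff₀ hs] at h8
    rw [lt_div_iff₀ hs]
    linarith
  · filter_upwards [eventually_gt_atTop 0] with n hn
    have hn0 : (0:ℝ) < n := by exact_mod_cast hn
    have hs : 0 < Real.sqrt n := Real.sqrt_pos.2 hn0
    refine lt_of_le_of_lt ?_ hb
    rw [div_le_iff₀ hs]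
    have hsa : 0 < Real.sqrt (Real.pi^2/6) := Real.sqrt_pos.2 ha0
    refine (log_p_le n (t := Real.sqrt (Real.pi^2/6) / Real.sqrt n) (by positivity)).trans
      (le_of_eq ?_)
    generalize hA : Real.sqrt (Real.pi^2/6) = A at *
    generalize hB : Real.sqrt n = B at *
    have e1 : (n:ℝ) = B^2 := by rw [← hB, Real.sq_sqrt hn0.le]
    have e2 : Real.pi^2/6 = A^2 := by rw [← hA, Real.sq_sqrt ha0.le]
    rw [e1, e2]; field_simp; ring

end PartAsym

/-- Hardy–Ramanujan growth of the partition function: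
`(log p(n))² / n → 2π²/3`, i.e. the effective central charge of
`1/(q;q)_∞ = ∑ p(n) qⁿ` equals `1`. -/
theorem stmt1 :
    Tendsto (fun n : ℕ => (Real.log (Fintype.card (Nat.Partition n))) ^ 2 / n) atTop
      (nhds (2 * Real.pi ^ 2 / 3)) ∧
    (3 / (2 * Real.pi ^ 2)) *
        limsup (fun n : ℕ => (Real.log (Fintype.card (Nat.Partition n))) ^ 2 / n) atTop = 1 := by
  have h : Tendsto (fun n : ℕ => (Real.log (Fintype.card (Nat.Partition n))) ^ 2 / n) atTop
      (nhds (2 * Real.pi ^ 2 / 3)) := by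
    have h1 := PartAsym.tendsto_main.pow 2
    have e : (2 * Real.sqrt (Real.pi^2/6))^2 = 2 * Real.pi ^ 2 / 3 := by
      rw [mul_pow, Real.sq_sqrt (by positivity)]; ring
    rw [e] at h1
    refine h1.congr fun n => ?_
    rw [div_pow, Real.sq_sqrt (Nat.cast_nonneg n)]
    rfl
  refine ⟨h, ?_⟩
  rw [h.limsup_eq]
  have := Real.pi_ne_zero
  field_simp
end

section
/- Let s, t ≥ 2 be coprime integers. Then st − s − t is an odd positive integer, and j₀ := (st − s − t − 1)/2 is the least natural number j such that 2j+1 is congruent modulo 2st to one of st+(s+t), st−(s+t), st+(s−t), st−(s−t); that is, j₀ is the least j with ε(j) ≠ 0. -/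
/-- `ε(j) ∈ {−1,0,1}`: it is `−1` if `2j+1 ≡ st ± (s+t) (mod 2st)`, `+1` if
`2j+1 ≡ st ± (s−t) (mod 2st)`, and `0` otherwise. -/
def eps (s t : ℤ) (j : ℕ) : ℤ :=
  if (2 * (j : ℤ) + 1) ≡ s * t + (s + t) [ZMOD 2 * s * t] ∨
      (2 * (j : ℤ) + 1) ≡ s * t - (s + t) [ZMOD 2 * s * t] then -1
  else if (2 * (j : ℤ) + 1) ≡ s * t + (s - t) [ZMOD 2 * s * t] ∨
      (2 * (j : ℤ) + 1) ≡ s * t - (s - t) [ZMOD 2 * s * t] then 1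
  else 0

/-- Any representative `x > 0` of a class `c` with `st-s-t ≤ c ≤ st+s+t` is at least `st-s-t`. -/
theorem eps_bound (s t x c : ℤ) (hpos : 0 < s * t - s - t) (hx : 0 < x)
    (hP : 0 < s * t) (h1 : s * t - s - t ≤ c) (h2 : c ≤ s * t + s + t)
    (h : x ≡ c [ZMOD 2 * s * t]) : s * t - s - t ≤ x := by
  obtain ⟨k, hk⟩ := h.dvd
  have hk' : c - x = 2 * (s * t * k) := by rw [hk]; ring
  rcases le_or_gt k 0 with h0 | h0
  · nlinarith
  · nlinarith

/-- For coprime integers `s, t ≥ 2`, `st − s − t` is an odd positive integer,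
and `j₀ = (st − s − t − 1)/2` is the least natural number `j` with `ε(j) ≠ 0`. -/
theorem stmt2 (s t : ℤ) (hs : 2 ≤ s) (ht : 2 ≤ t) (hst : IsCoprime s t) :
    Odd (s * t - s - t) ∧ 0 < s * t - s - t ∧
      IsLeast {j : ℕ | eps s t j ≠ 0} ((s * t - s - t - 1) / 2).toNat := by
  have hodd : Odd (s * t - s - t) := by
    rcases Int.even_or_odd s with h | h
    · rcases Int.even_or_odd t with h' | h'
      · exfalso
        have h2 : IsUnit (2 : ℤ) := hst.isUnit_of_dvd' h.two_dvd h'.two_dvd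
        rw [Int.isUnit_iff] at h2
        omega
      · exact ((h.mul_right t).sub h).sub_odd h'
    · rcases Int.even_or_odd t with h' | h'
      · exact ((h'.mul_left s).sub_odd h).sub_even h'
      · exact ((h.mul h').sub_odd h).sub_odd h'
  have hpos : 0 < s * t - s - t := by
    have h0 : 0 ≤ s * t - s - t := by nlinarith
    rcases h0.lt_or_eq with h | h
    · exact h
    · rw [← h] at hodd
      exact absurd hodd (by decide)
  refine ⟨hodd, hpos, ?_, ?_⟩
  · obtain ⟨m, hm⟩ := hodd
    have hj : 2 * ((((s * t - s - t - 1) / 2).toNat : ℕ) : ℤ) + 1 = s * t - (s + t) := by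
      omega
    have hc : (2 * ((((s * t - s - t - 1) / 2).toNat : ℕ) : ℤ) + 1) ≡ s * t - (s + t)
        [ZMOD 2 * s * t] := by rw [hj]
    show eps s t _ ≠ 0
    unfold eps
    rw [if_pos (Or.inr hc)]
    decide
  · intro j hj
    have hP : 0 < s * t := by linarith
    have key : s * t - s - t ≤ 2 * (j : ℤ) + 1 := by
      have hx : 0 < 2 * (j : ℤ) + 1 := by omega
      change eps s t j ≠ 0 at hj
      unfold eps at hj
      split_ifs at hj with ha hb
      · rcases ha with h | h
        · exact eps_bound s t _ _ hpos hx hP (by linarith) (by linarith) h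
        · exact eps_bound s t _ _ hpos hx hP (by linarith) (by linarith) h
      · rcases hb with h | h
        · exact eps_bound s t _ _ hpos hx hP (by linarith) (by linarith) h
        · exact eps_bound s t _ _ hpos hx hP (by linarith) (by linarith) h
      · exact absurd rfl hj
    omega
end

section
/- Let s, t ≥ 2 be coprime integers and σ ∈ {+1, −1}. Let E be the set of rational numbers {φᵢ(j,k) : i ∈ {1,2,3,4}, j, k ∈ ℕ, k ≥ j+1, ε(j) ≠ 0}. Set j₀ = (st−s−t−1)/2 and Δ = 1/2 + σ·j₀(j₀+1)/(st) + σ·(t²−1)(s²−1)/(4st) + (j₀²+j₀)/2. Then Δ ∈ E, and every element of E equals Δ + n for some n ∈ ℕ; in particular Δ is the minimum of E. (This is the statement that the q-series given by the regularized +1-surgery formula for Ẑ(Σ̄(s,t,st∓1)) lies in q^Δ·ℤ[[q]] for this value of Δ.) -/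
/-- `φ₁(j,k) = 1/2 + σ·j(j+1)/(st) + σ·(t²−1)(s²−1)/(4st) − j² + (3k²+k)/2`. -/
def phi1 (s t σ : ℤ) (j k : ℕ) : ℚ :=
  1 / 2 + (σ : ℚ) * ((j : ℚ) * ((j : ℚ) + 1)) / ((s : ℚ) * (t : ℚ))
    + (σ : ℚ) * (((t : ℚ) ^ 2 - 1) * ((s : ℚ) ^ 2 - 1)) / (4 * (s : ℚ) * (t : ℚ))
    - (j : ℚ) ^ 2 + (3 * (k : ℚ) ^ 2 + (k : ℚ)) / 2

/-- `φᵢ` for `i ∈ {1,2,3,4}`: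
`φ₂ = φ₁ − k`, `φ₃ = φ₁ − (2j+1)`, `φ₄ = φ₁ − k − (2j+1)`. -/
def phi (s t σ : ℤ) (i j k : ℕ) : ℚ :=
  match i with
  | 1 => phi1 s t σ j k
  | 2 => phi1 s t σ j k - (k : ℚ)
  | 3 => phi1 s t σ j k - (2 * (j : ℚ) + 1)
  | 4 => phi1 s t σ j k - (k : ℚ) - (2 * (j : ℚ) + 1)
  | _ => 0

lemma cop_parity {s t : ℤ} (h : IsCoprime s t) : ¬ (2 ∣ s ∧ 2 ∣ t) := by
  rintro ⟨⟨a, rfl⟩, ⟨b, rfl⟩⟩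
  obtain ⟨x, y, hxy⟩ := h
  have : 2 * (x * a + y * b) = 1 := by linarith
  omega

lemma exists_J {s t : ℤ} (hs : 2 ≤ s) (ht : 2 ≤ t) (h : IsCoprime s t) :
    ∃ J : ℕ, 2 * (J : ℤ) + 1 = s * t - s - t := by
  have hp := cop_parity h
  have h1 : 0 ≤ s * t - s - t := by nlinarith
  have h2 : (s * t - s - t) % 2 = 1 := by
    rcases Int.even_or_odd' s with ⟨a, rfl | rfl⟩ <;> rcases Int.even_or_odd' t with ⟨b, rfl | rfl⟩
    · exact absurd ⟨⟨a, rfl⟩, ⟨b, rfl⟩⟩ hp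
    · have : 2 * a * (2 * b + 1) - 2 * a - (2 * b + 1) = 2 * (a * (2 * b + 1) - a - b - 1) + 1 := by ring
      omega
    · have : (2 * a + 1) * (2 * b) - (2 * a + 1) - 2 * b = 2 * ((2 * a + 1) * b - a - b - 1) + 1 := by ring
      omega
    · have : (2 * a + 1) * (2 * b + 1) - (2 * a + 1) - (2 * b + 1) = 2 * (2 * a * b - 1) + 1 := by ring
      omega
  exact ⟨((s * t - s - t) / 2).toNat, by omega⟩

lemma key {s t : ℤ} (hs : 2 ≤ s) (ht : 2 ≤ t) {J j : ℕ}
    (hJ : 2 * (J : ℤ) + 1 = s * t - s - t) (e f c : ℤ) (he : e = 1 ∨ e = -1) (hf : f = 1 ∨ f = -1)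
    (hm : 2 * (j : ℤ) + 1 = s * t + e * (s + f * t) + 2 * s * t * c) :
    ∃ d : ℤ, 0 ≤ d ∧ (j : ℤ) * (j + 1) - J * (J + 1) = s * t * d := by
  have hst : 0 < s * t := by positivity
  obtain ⟨w, hw⟩ : ∃ w : ℤ, (2 * c + 1) * (e * (s + f * t)) + f + s + t - 1 = 2 * w := by
    rcases he with rfl | rfl <;> rcases hf with rfl | rfl
    · exact ⟨(c + 1) * (s + t), by ring⟩
    · exact ⟨c * (s - t) + s - 1, by ring⟩
    · exact ⟨- c * (s + t), by ring⟩
    · exact ⟨- c * (s - t) + t - 1, by ring⟩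
  have hd : (j : ℤ) * (j + 1) - J * (J + 1) = s * t * (s * t * (c * (c + 1)) + w) := by
    have h4 : 4 * ((j : ℤ) * (j + 1) - J * (J + 1)) = (2 * (j : ℤ) + 1) ^ 2 - (2 * (J : ℤ) + 1) ^ 2 := by ring
    rw [hm, hJ] at h4
    have he2 : e ^ 2 = 1 := by rcases he with rfl | rfl <;> norm_num
    have hf2 : f ^ 2 = 1 := by rcases hf with rfl | rfl <;> norm_num
    have h5 : 4 * ((j : ℤ) * (j + 1) - J * (J + 1))
        = 4 * (s * t * (s * t * (c * (c + 1)) + w)) := by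
      linear_combination h4 + 2 * s * t * hw + (s + f * t) ^ 2 * he2 + t ^ 2 * hf2
    linarith
  refine ⟨_, ?_, hd⟩
  have hle : (J : ℤ) ≤ j := by
    have hc : 0 ≤ c := by
      by_contra hc
      have : s * t * (c + 1) ≤ 0 := mul_nonpos_of_nonneg_of_nonpos hst.le (by omega)
      have : e * (s + f * t) ≤ s + t := by
        rcases he with rfl | rfl <;> rcases hf with rfl | rfl <;> linarith
      nlinarith
    have : 0 ≤ s * t * c := by positivity
    have : - (s + t) ≤ e * (s + f * t) := by
      rcases he with rfl | rfl <;> rcases hf with rfl | rfl <;> linarith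
    nlinarith
  have h0 : 0 ≤ (j : ℤ) * (j + 1) - J * (J + 1) := by nlinarith
  rw [hd] at h0
  exact nonneg_of_mul_nonneg_right h0 hst

lemma key' {s t : ℤ} (hs : 2 ≤ s) (ht : 2 ≤ t) {J j : ℕ}
    (hJ : 2 * (J : ℤ) + 1 = s * t - s - t) (h : eps s t j ≠ 0) :
    ∃ d : ℤ, 0 ≤ d ∧ (j : ℤ) * (j + 1) - J * (J + 1) = s * t * d := by
  unfold eps at h
  split_ifs at h with h1 h2
  · rcases h1 with h1 | h1 <;> obtain ⟨c, hc⟩ := h1.symm.dvd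
    · exact key hs ht hJ 1 1 c (by simp) (by simp) (by linarith)
    · exact key hs ht hJ (-1) 1 c (by simp) (by simp) (by linarith)
  · rcases h2 with h1 | h1 <;> obtain ⟨c, hc⟩ := h1.symm.dvd
    · exact key hs ht hJ 1 (-1) c (by simp) (by simp) (by linarith)
    · exact key hs ht hJ (-1) (-1) c (by simp) (by simp) (by linarith)
  · exact absurd rfl h

/-- For coprime `s, t ≥ 2` and `σ = ±1`, with
`E = {φᵢ(j,k) : i ∈ {1,2,3,4}, k ≥ j+1, ε(j) ≠ 0}`, `j₀ = (st−s−t−1)/2` and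
`Δ = 1/2 + σ·j₀(j₀+1)/(st) + σ·(t²−1)(s²−1)/(4st) + (j₀²+j₀)/2`, one has `Δ ∈ E`,
every element of `E` is `Δ + n` for some `n ∈ ℕ`, and `Δ` is the minimum of `E`. -/
theorem stmt4 (s t σ : ℤ) (hs : 2 ≤ s) (ht : 2 ≤ t) (hst : IsCoprime s t)
    (hσ : σ = 1 ∨ σ = -1) :
    let E : Set ℚ := {x | ∃ i j k : ℕ, (i = 1 ∨ i = 2 ∨ i = 3 ∨ i = 4) ∧
      j + 1 ≤ k ∧ eps s t j ≠ 0 ∧ x = phi s t σ i j k}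
    let j₀ : ℚ := ((s : ℚ) * (t : ℚ) - (s : ℚ) - (t : ℚ) - 1) / 2
    let Δ : ℚ := 1 / 2 + (σ : ℚ) * (j₀ * (j₀ + 1)) / ((s : ℚ) * (t : ℚ))
      + (σ : ℚ) * (((t : ℚ) ^ 2 - 1) * ((s : ℚ) ^ 2 - 1)) / (4 * (s : ℚ) * (t : ℚ))
      + (j₀ ^ 2 + j₀) / 2
    Δ ∈ E ∧ (∀ x ∈ E, ∃ n : ℕ, x = Δ + (n : ℚ)) ∧ IsLeast E Δ := by
  intro E j₀ Δ
  obtain ⟨J, hJ⟩ := exists_J hs ht hst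
  have hJq : j₀ = (J : ℚ) := by
    have : (2 * (J : ℚ) + 1) = s * t - s - t := by exact_mod_cast hJ
    simp only [j₀]; linarith
  have hs0 : (s : ℚ) ≠ 0 := by exact_mod_cast (by omega : s ≠ 0)
  have ht0 : (t : ℚ) ≠ 0 := by exact_mod_cast (by omega : t ≠ 0)
  have hmem : Δ ∈ E := by
    refine ⟨4, J, J + 1, by simp, le_rfl, ?_, ?_⟩
    · unfold eps
      rw [if_pos]
      · norm_num
      · right
        rw [hJ, show s * t - s - t = s * t - (s + t) by ring]
    · simp only [Δ, hJq, phi, phi1]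
      push_cast
      ring
  have hmain : ∀ x ∈ E, ∃ n : ℕ, x = Δ + (n : ℚ) := by
    rintro x ⟨i, j, k, hi, hk, he, rfl⟩
    obtain ⟨d, hd0, hd⟩ := key' hs ht hJ he
    obtain ⟨A, hA⟩ : ∃ A : ℤ, 3 * (k : ℤ) ^ 2 + k = 2 * A := by
      obtain ⟨r, hr⟩ := Int.even_mul_succ_self (k : ℤ)
      exact ⟨r + k ^ 2, by linarith⟩
    obtain ⟨B, hB⟩ : ∃ B : ℤ, (J : ℤ) ^ 2 + J = 2 * B := by
      obtain ⟨r, hr⟩ := Int.even_mul_succ_self (J : ℤ)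
      exact ⟨r, by linarith⟩
    have hst4 : 4 ≤ s * t := by nlinarith
    have hkz : (j : ℤ) + 1 ≤ k := by exact_mod_cast hk
    have hj0 : (0 : ℤ) ≤ j := by positivity
    have hn : 0 ≤ σ * d - j ^ 2 + A - B - k - (2 * j + 1) := by
      have h1 : -d ≤ σ * d := by rcases hσ with rfl | rfl <;> linarith
      have h2 : 2 * d ≤ s * t * d := by nlinarith
      have h3 : (3 * ((j : ℤ) + 1) ^ 2 - (j + 1)) ≤ 3 * (k : ℤ) ^ 2 - k := by nlinarith
      nlinarith
    have hAq : 3 * (k : ℚ) ^ 2 + k = 2 * A := by exact_mod_cast hA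
    have hBq : (J : ℚ) ^ 2 + J = 2 * B := by exact_mod_cast hB
    have hdq : (j : ℚ) * (j + 1) = J * (J + 1) + s * t * d := by
      have : (j : ℚ) * (j + 1) - J * (J + 1) = s * t * d := by exact_mod_cast hd
      linarith
    have hphi : phi1 s t σ j k = Δ + ((σ * d - j ^ 2 + A - B : ℤ) : ℚ) := by
      simp only [Δ, hJq, phi1]
      rw [hAq, hBq, hdq]
      push_cast
      field_simp
      ring
    rcases hi with rfl | rfl | rfl | rfl
    · refine ⟨(σ * d - j ^ 2 + A - B).toNat, ?_⟩
      have : (((σ * d - j ^ 2 + A - B).toNat : ℤ) : ℚ) = ((σ * d - j ^ 2 + A - B : ℤ) : ℚ) := by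
        rw [Int.toNat_of_nonneg (by linarith)]
      rw [Int.cast_natCast] at this
      simp only [phi]
      rw [this, hphi]
    · refine ⟨(σ * d - j ^ 2 + A - B - k).toNat, ?_⟩
      have : (((σ * d - j ^ 2 + A - B - k).toNat : ℤ) : ℚ) = ((σ * d - j ^ 2 + A - B - k : ℤ) : ℚ) := by
        rw [Int.toNat_of_nonneg (by linarith)]
      rw [Int.cast_natCast] at this
      simp only [phi]
      rw [this, hphi]
      push_cast; ring
    · refine ⟨(σ * d - j ^ 2 + A - B - (2 * j + 1)).toNat, ?_⟩
      have : (((σ * d - j ^ 2 + A - B - (2 * j + 1)).toNat : ℤ) : ℚ)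
          = ((σ * d - j ^ 2 + A - B - (2 * j + 1) : ℤ) : ℚ) := by
        rw [Int.toNat_of_nonneg (by linarith)]
      rw [Int.cast_natCast] at this
      simp only [phi]
      rw [this, hphi]
      push_cast; ring
    · refine ⟨(σ * d - j ^ 2 + A - B - k - (2 * j + 1)).toNat, ?_⟩
      have : (((σ * d - j ^ 2 + A - B - k - (2 * j + 1)).toNat : ℤ) : ℚ)
          = ((σ * d - j ^ 2 + A - B - k - (2 * j + 1) : ℤ) : ℚ) := by
        rw [Int.toNat_of_nonneg hn]
      rw [Int.cast_natCast] at this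
      simp only [phi]
      rw [this, hphi]
      push_cast; ring
  refine ⟨hmem, hmain, hmem, ?_⟩
  intro x hx
  obtain ⟨n, rfl⟩ := hmain x hx
  have : (0 : ℚ) ≤ n := by positivity
  linarith
end

section
/- Let s, t ≥ 2 be coprime integers and σ ∈ {+1,−1}. Set j₀ = (st−s−t−1)/2 and Δ = 1/2 + σ·j₀(j₀+1)/(st) + σ·(t²−1)(s²−1)/(4st) + (j₀²+j₀)/2. For n ∈ ℕ define the integer b_n = Σ ε(j)·(−1)^k·sᵢ, where the sum runs over all (i,j,k) with i ∈ {1,2,3,4}, j,k ∈ ℕ, k ≥ j+1, ε(j) ≠ 0 and φᵢ(j,k) = Δ + n, and where s₁ = s₂ = +1, s₃ = s₄ = −1. Let p(n) denote the number of partitions of n and set c_n = Σ_{m=0}^{n} p(n−m)·b_m. Then limsup_{n→∞} (log|c_n|)²/n ≤ 2π²/3; that is, the effective central charge of the regularized +1-surgery series Ẑ(Σ̄(s,t,st±1); q) is at most 1. -/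
open Filter

lemma card_part_le (n : ℕ) (x : ℝ) (hx0 : 0 < x) (hx1 : x < 1) :
    (Fintype.card (Nat.Partition n) : ℝ) * x ^ n ≤
      ∏ k ∈ Finset.range n, (1 - x ^ (k + 1))⁻¹ := by
  classical
  have h1 : (Fintype.card (Nat.Partition n) : ℝ) * x ^ n
      = ∑ p : Nat.Partition n, ∏ k ∈ Finset.range n, x ^ ((k + 1) * p.parts.count (k + 1)) := by
    rw [← nsmul_eq_mul, ← Finset.card_univ, ← Finset.sum_const]
    refine Finset.sum_congr rfl fun p _ => ?_
    rw [Finset.prod_pow_eq_pow_sum]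
    congr 1
    have h2 : p.parts.sum = ∑ m ∈ Finset.Icc 1 n, p.parts.count m * m := by
      rw [Finset.sum_multiset_count_of_subset p.parts (Finset.Icc 1 n)]
      · simp
      · intro m hm
        rw [Multiset.mem_toFinset] at hm
        have := p.parts_pos hm
        have := Nat.Partition.le_of_mem_parts hm
        simp; omega
    rw [p.parts_sum] at h2
    conv_lhs => rw [h2]
    rw [Finset.sum_bij' (fun m _ => m - 1) (fun k _ => k + 1)]
    all_goals simp
    all_goals grind
  have h3 : ∀ k ∈ Finset.range n, ∑ i ∈ Finset.range (n + 1), x ^ ((k + 1) * i) ≤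
      (1 - x ^ (k + 1))⁻¹ := by
    intro k _
    have hy0 : 0 ≤ x ^ (k + 1) := by positivity
    have hy1 : x ^ (k + 1) < 1 := pow_lt_one₀ hx0.le hx1 (by omega)
    rw [← tsum_geometric_of_lt_one hy0 hy1]
    simp_rw [pow_mul]
    exact (summable_geometric_of_lt_one hy0 hy1).sum_le_tsum _ (fun i _ => by positivity)
  refine le_trans ?_ (Finset.prod_le_prod (fun k _ => by positivity) h3)
  rw [h1, Finset.prod_sum]
  have key : ∀ p : Nat.Partition n, ∏ k ∈ Finset.range n, x ^ ((k + 1) * p.parts.count (k + 1))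
     = ∏ k ∈ (Finset.range n).attach, x ^ ((k.1 + 1) * p.parts.count (k.1 + 1)) := fun p =>
    (Finset.prod_attach (Finset.range n) (fun k => x ^ ((k + 1) * p.parts.count (k + 1)))).symm
  simp_rw [key]
  let g : Nat.Partition n → ((k : ℕ) → k ∈ Finset.range n → ℕ) :=
    fun p k _ => p.parts.count (k + 1)
  have hg : Function.Injective g := by
    intro p q hpq
    apply Nat.Partition.ext
    ext m
    by_cases hm : 1 ≤ m ∧ m ≤ n
    · have := congrFun (congrFun hpq (m - 1)) (by simp; omega)
      simp only [g] at this
      rwa [Nat.sub_add_cancel hm.1] at this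
    · have : ∀ r : Nat.Partition n, r.parts.count m = 0 := by
        intro r
        rw [Multiset.count_eq_zero]
        intro hmr
        exact hm ⟨r.parts_pos hmr, Nat.Partition.le_of_mem_parts hmr⟩
      rw [this, this]
  have h5 := Finset.sum_image (s := Finset.univ) (g := g)
    (f := fun f => ∏ k ∈ (Finset.range n).attach, x ^ ((k.1 + 1) * f k.1 k.2)) (hg.injOn)
  refine h5.symm.le.trans ?_
  refine Finset.sum_le_sum_of_subset_of_nonneg ?_ (fun _ _ _ => by positivity)
  intro f hf
  rw [Finset.mem_image] at hf
  obtain ⟨p, _, rfl⟩ := hf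
  rw [Finset.mem_pi]
  intro k hk
  simp only [g, Finset.mem_range]
  have h6 : p.parts.count (k + 1) ≤ p.parts.card := Multiset.count_le_card _ _
  have h7 : p.parts.card ≤ p.parts.sum := by
    have := Multiset.card_nsmul_le_sum (s := p.parts) (a := 1) (fun i hi => p.parts_pos hi)
    simpa using this
  rw [p.parts_sum] at h7
  omega

lemma log_prod_le (n : ℕ) (x : ℝ) (hx0 : 0 < x) (hx1 : x < 1) :
    Real.log (∏ k ∈ Finset.range n, (1 - x ^ (k + 1))⁻¹) ≤ Real.pi ^ 2 / 6 * (x / (1 - x)) := by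
  have hy1 : ∀ k : ℕ, x ^ (k + 1) < 1 := fun k => pow_lt_one₀ hx0.le hx1 (by omega)
  rw [Real.log_prod (fun k _ => inv_ne_zero (sub_pos.mpr (hy1 k)).ne')]
  have hs : HasSum (fun m : ℕ => ∑ k ∈ Finset.range n, (x ^ (k + 1)) ^ (m + 1) / ((m : ℝ) + 1))
      (∑ k ∈ Finset.range n, Real.log (1 - x ^ (k + 1))⁻¹) := by
    refine hasSum_sum fun k _ => ?_
    rw [Real.log_inv]
    refine Real.hasSum_pow_div_log_of_abs_lt_one ?_
    rw [abs_of_pos (by positivity)]; exact hy1 k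
  have hz : HasSum (fun m : ℕ => 1 / ((m : ℝ) + 1) ^ 2 * (x / (1 - x)))
      (Real.pi ^ 2 / 6 * (x / (1 - x))) := by
    refine HasSum.mul_right _ ?_
    have := (hasSum_nat_add_iff' 1).mpr hasSum_zeta_two
    simpa using this
  refine hasSum_le (fun m => ?_) hs hz
  rw [← Finset.sum_div]
  have hm : (0 : ℝ) < (m : ℝ) + 1 := by positivity
  have h1x : 0 < 1 - x := by linarith
  set y := x ^ (m + 1) with hy
  have hy0 : 0 < y := by positivity
  have hylt : y < 1 := hy1 m
  have h1 : ∑ k ∈ Finset.range n, (x ^ (k + 1)) ^ (m + 1) ≤ y / (1 - y) := by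
    have : ∀ k ∈ Finset.range n, (x ^ (k + 1)) ^ (m + 1) = y * y ^ k := by
      intro k _
      rw [hy]; ring
    rw [Finset.sum_congr rfl this, ← Finset.mul_sum, div_eq_mul_inv]
    refine mul_le_mul_of_nonneg_left ?_ hy0.le
    rw [← tsum_geometric_of_lt_one hy0.le hylt]
    exact (summable_geometric_of_lt_one hy0.le hylt).sum_le_tsum _ (fun i _ => by positivity)
  have h2 : y / (1 - y) ≤ x / (1 - x) / ((m : ℝ) + 1) := by
    have hgeo : 1 - y = (∑ i ∈ Finset.range (m + 1), x ^ i) * (1 - x) := by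
      have := geom_sum_mul x (m + 1)
      rw [hy]; linarith
    have hge : ((m : ℝ) + 1) * x ^ m ≤ ∑ i ∈ Finset.range (m + 1), x ^ i := by
      have : ∑ i ∈ Finset.range (m + 1), x ^ m ≤ ∑ i ∈ Finset.range (m + 1), x ^ i := by
        refine Finset.sum_le_sum fun i hi => ?_
        refine pow_le_pow_of_le_one hx0.le hx1.le ?_
        have := Finset.mem_range.mp hi; omega
      simpa using this
    rw [div_div, div_le_div_iff₀ (by linarith) (by positivity), hgeo, hy, pow_succ]
    have : 0 ≤ x * (1 - x) := by positivity
    nlinarith [mul_le_mul_of_nonneg_left hge this]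
  calc _ ≤ (x / (1 - x) / ((m : ℝ) + 1)) / ((m : ℝ) + 1) := by
        gcongr; exact h1.trans h2
    _ = _ := by field_simp

lemma card_part_le_exp (n : ℕ) :
    (Fintype.card (Nat.Partition n) : ℝ) ≤ Real.exp (Real.pi * √(2 * n / 3)) := by
  rcases Nat.eq_zero_or_pos n with rfl | hn
  · simp [Fintype.card_unique]
  have hn' : (0 : ℝ) < n := by exact_mod_cast hn
  have hpi := Real.pi_pos
  set r := √(2 * n / 3) with hr
  have hr0 : 0 < r := by positivity
  have hr2 : r ^ 2 = 2 * n / 3 := Real.sq_sqrt (by positivity)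
  -- u = π / (3 r)
  set u := Real.pi / (3 * r) with hu
  have hu0 : 0 < u := by positivity
  have hx0 : 0 < (1 + u)⁻¹ := by positivity
  have hx1 : (1 + u)⁻¹ < 1 := inv_lt_one_of_one_lt₀ (by linarith)
  have h1 := card_part_le n _ hx0 hx1
  have h2 := log_prod_le n _ hx0 hx1
  have hp : (0 : ℝ) < Fintype.card (Nat.Partition n) := by
    exact_mod_cast Fintype.card_pos
  have h3 := Real.log_le_log (by positivity) h1
  rw [Real.log_mul hp.ne' (by positivity), Real.log_pow, Real.log_inv] at h3
  have h4 : Real.log (1 + u) ≤ u := by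
    have := Real.log_le_sub_one_of_pos (show 0 < 1 + u by linarith); linarith
  have h5 : (1 + u)⁻¹ / (1 - (1 + u)⁻¹) = 1 / u := by
    have hd : 1 - (1 + u)⁻¹ = u * (1 + u)⁻¹ := by field_simp; ring
    rw [hd]; field_simp
  rw [h5] at h2
  have h6 : (n : ℝ) * Real.log (1 + u) ≤ n * u := by gcongr
  rw [← Real.log_le_iff_le_exp hp]
  have h7 : Real.pi ^ 2 / 6 * (1 / u) + n * u = Real.pi * r := by
    have : (n : ℝ) = 3 * r ^ 2 / 2 := by rw [hr2]; ring
    rw [this, hu]; field_simp; ring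
  linarith

lemma phi_lower (s t σ : ℤ) (hs : 2 ≤ s) (ht : 2 ≤ t) (hσ : σ = 1 ∨ σ = -1) :
    ∃ C : ℚ, ∀ i j k : ℕ, (i = 1 ∨ i = 2 ∨ i = 3 ∨ i = 4) → j + 1 ≤ k →
      (k : ℚ) ^ 2 / 4 - 5 * k - C ≤ phi s t σ i j k := by
  set D := (σ : ℚ) * (((t : ℚ) ^ 2 - 1) * ((s : ℚ) ^ 2 - 1)) / (4 * (s : ℚ) * (t : ℚ)) with hD
  refine ⟨-D, fun i j k hi hjk => ?_⟩
  have hsq : (2 : ℚ) ≤ s := by exact_mod_cast hs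
  have htq : (2 : ℚ) ≤ t := by exact_mod_cast ht
  have hst : (4 : ℚ) ≤ s * t := by nlinarith
  have hj0 : (0 : ℚ) ≤ j := by positivity
  have hk : (j : ℚ) + 1 ≤ k := by exact_mod_cast hjk
  have hA : -((j : ℚ) * (j + 1) / 4) ≤ (σ : ℚ) * ((j : ℚ) * ((j : ℚ) + 1)) / ((s : ℚ) * (t : ℚ)) := by
    have h0 : (0 : ℚ) ≤ (j : ℚ) * (j + 1) := by positivity
    have h1 : (j : ℚ) * (j + 1) / (s * t) ≤ (j : ℚ) * (j + 1) / 4 := by gcongr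
    have h2 : 0 ≤ (j : ℚ) * (j + 1) / (s * t) := by positivity
    rcases hσ with rfl | rfl
    · push_cast; rw [one_mul]; linarith
    · push_cast; rw [neg_one_mul, neg_div]; linarith
  have hB : phi1 s t σ j k - k - (2 * j + 1) ≥ (k : ℚ) ^ 2 / 4 - 5 * k + D := by
    unfold phi1
    rw [← hD]
    nlinarith
  rcases hi with rfl | rfl | rfl | rfl <;> simp only [phi] <;> linarith

lemma b_bound (s t σ : ℤ) (hs : 2 ≤ s) (ht : 2 ≤ t) (hσ : σ = 1 ∨ σ = -1) (Δ : ℚ) (b : ℕ → ℤ)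
    (hb : ∀ n : ℕ, b n =
      ∑ᶠ p ∈ {p : ℕ × ℕ × ℕ | (p.1 = 1 ∨ p.1 = 2 ∨ p.1 = 3 ∨ p.1 = 4) ∧
          p.2.1 + 1 ≤ p.2.2 ∧ eps s t p.2.1 ≠ 0 ∧
          phi s t σ p.1 p.2.1 p.2.2 = Δ + (n : ℚ)},
        eps s t p.2.1 * (-1 : ℤ) ^ p.2.2 * (if p.1 = 1 ∨ p.1 = 2 then 1 else -1)) :
    ∃ M : ℕ, ∀ n, |b n| ≤ 5 * ((4 * n + M : ℕ) : ℤ) ^ 2 := by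
  obtain ⟨C, hC⟩ := phi_lower s t σ hs ht hσ
  obtain ⟨M, hM⟩ := exists_nat_gt (20 + 4 * |C + Δ|)
  refine ⟨M, fun n => ?_⟩
  rw [hb]
  set S := {p : ℕ × ℕ × ℕ | (p.1 = 1 ∨ p.1 = 2 ∨ p.1 = 3 ∨ p.1 = 4) ∧
          p.2.1 + 1 ≤ p.2.2 ∧ eps s t p.2.1 ≠ 0 ∧
          phi s t σ p.1 p.2.1 p.2.2 = Δ + (n : ℚ)} with hS
  set N := 4 * n + M with hN
  let F := Finset.range 5 ×ˢ Finset.range N ×ˢ Finset.range N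
  have hSF : S ⊆ ↑F := by
    rintro ⟨i, j, k⟩ ⟨hi, hjk, _, he⟩
    simp only at hi hjk he
    have h1 := hC i j k hi hjk
    rw [he] at h1
    have hkN : k < N := by
      by_contra! hcon
      have h2 : (4 * (n : ℚ) + M) ≤ k := by exact_mod_cast hcon
      have h3 := le_abs_self (C + Δ)
      have h4 : (1 : ℚ) ≤ k := by exact_mod_cast (by omega : 1 ≤ k)
      have h5 : (0 : ℚ) ≤ n := by positivity
      have h6 := abs_nonneg (C + Δ)
      have h7 : 0 < (k : ℚ) - 20 - 4 * |C + Δ| - 4 * n := by linarith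
      nlinarith [mul_pos (show (0 : ℚ) < k by linarith) h7]
    simp only [F, Finset.coe_product, Set.mem_prod, Finset.coe_range, Set.mem_Iio]
    omega
  have hfin : S.Finite := F.finite_toSet.subset hSF
  rw [finsum_mem_eq_finite_toFinset_sum _ hfin]
  refine (Finset.abs_sum_le_sum_abs _ _).trans ?_
  refine (Finset.sum_le_card_nsmul _ _ 1 ?_).trans ?_
  · intro p _
    rw [abs_mul, abs_mul, abs_pow]
    unfold eps
    split_ifs <;> simp
  · have : hfin.toFinset.card ≤ F.card := Finset.card_le_card (by simpa using hSF)
    have hF : F.card = 5 * N ^ 2 := by simp [F]; ring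
    rw [hF] at this
    simp only [nsmul_eq_mul, mul_one]
    exact_mod_cast this

/-- With `Δ` as in the regularized `+1`-surgery formula, the coefficients
`c n = ∑_{m≤n} p(n−m)·b m` of `Ẑ(Σ̄(s,t,st±1); q)` satisfy
`limsup (log|c n|)²/n ≤ 2π²/3`, i.e. the effective central charge is at most `1`. -/
theorem stmt6 (s t σ : ℤ) (hs : 2 ≤ s) (ht : 2 ≤ t) (hst : IsCoprime s t)
    (hσ : σ = 1 ∨ σ = -1)
    (j₀ : ℚ) (hj₀ : j₀ = ((s : ℚ) * (t : ℚ) - (s : ℚ) - (t : ℚ) - 1) / 2)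
    (Δ : ℚ)
    (hΔ : Δ = 1 / 2 + (σ : ℚ) * (j₀ * (j₀ + 1)) / ((s : ℚ) * (t : ℚ))
      + (σ : ℚ) * (((t : ℚ) ^ 2 - 1) * ((s : ℚ) ^ 2 - 1)) / (4 * (s : ℚ) * (t : ℚ))
      + (j₀ ^ 2 + j₀) / 2)
    (b : ℕ → ℤ)
    (hb : ∀ n : ℕ, b n =
      ∑ᶠ p ∈ {p : ℕ × ℕ × ℕ | (p.1 = 1 ∨ p.1 = 2 ∨ p.1 = 3 ∨ p.1 = 4) ∧
          p.2.1 + 1 ≤ p.2.2 ∧ eps s t p.2.1 ≠ 0 ∧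
          phi s t σ p.1 p.2.1 p.2.2 = Δ + (n : ℚ)},
        eps s t p.2.1 * (-1 : ℤ) ^ p.2.2 * (if p.1 = 1 ∨ p.1 = 2 then 1 else -1))
    (c : ℕ → ℤ)
    (hc : ∀ n : ℕ, c n = ∑ m ∈ Finset.range (n + 1),
      (Fintype.card (Nat.Partition (n - m)) : ℤ) * b m) :
    limsup (fun n : ℕ => (Real.log |(c n : ℝ)|) ^ 2 / n) atTop ≤ 2 * Real.pi ^ 2 / 3 := by
  obtain ⟨M, hM⟩ := b_bound s t σ hs ht hσ Δ b hb
  -- polynomial times exponential bound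
  have hcb : ∀ n : ℕ, |(c n : ℝ)| ≤
      ((n : ℝ) + 1) * (5 * (4 * n + M) ^ 2) * Real.exp (Real.pi * √(2 * n / 3)) := by
    intro n
    rw [hc]
    push_cast
    refine (Finset.abs_sum_le_sum_abs _ _).trans ?_
    refine (Finset.sum_le_card_nsmul _ _
      ((5 * (4 * n + M) ^ 2) * Real.exp (Real.pi * √(2 * n / 3))) ?_).trans ?_
    · intro m hm
      have hmn : m ≤ n := by have := Finset.mem_range.mp hm; omega
      have hmn' : (m : ℝ) ≤ n := by exact_mod_cast hmn
      rw [abs_mul, mul_comm]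
      have h1 : |(b m : ℝ)| ≤ 5 * (4 * m + M) ^ 2 := by exact_mod_cast hM m
      have h2 : |(b m : ℝ)| ≤ 5 * (4 * n + M) ^ 2 := h1.trans (by gcongr)
      refine mul_le_mul h2 ?_ (abs_nonneg _) (by positivity)
      rw [abs_of_nonneg (by positivity)]
      refine (card_part_le_exp (n - m)).trans ?_
      have : ((n - m : ℕ) : ℝ) ≤ n := by exact_mod_cast Nat.sub_le n m
      have := Real.pi_pos
      gcongr
    · simp only [Finset.card_range, nsmul_eq_mul]
      push_cast
      exact le_of_eq (by ring)
  set K : ℝ := 5 * (4 + M) ^ 2 with hK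
  have hK1 : 1 ≤ K := by
    have : (0 : ℝ) ≤ M := by positivity
    nlinarith
  have hlog : ∀ n : ℕ, Real.log |(c n : ℝ)| ≤
      Real.log K + 3 * Real.log (n + 1) + Real.pi * √(2 * n / 3) := by
    intro n
    have hn0 : (0 : ℝ) ≤ n := by positivity
    have hM0 : (0 : ℝ) ≤ M := by positivity
    rcases eq_or_ne (c n) 0 with h0 | h0
    · rw [h0]; simp only [Int.cast_zero, abs_zero, Real.log_zero]
      have := Real.log_nonneg hK1
      have := Real.log_nonneg (show (1 : ℝ) ≤ n + 1 by linarith)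
      have := Real.pi_pos
      positivity
    · have hpos : 0 < |(c n : ℝ)| := abs_pos.mpr (by exact_mod_cast h0)
      have h1 : |(c n : ℝ)| ≤ K * (n + 1) ^ 3 * Real.exp (Real.pi * √(2 * n / 3)) := by
        refine (hcb n).trans ?_
        have : 4 * (n : ℝ) + M ≤ (4 + M) * (n + 1) := by nlinarith
        calc _ ≤ ((n : ℝ) + 1) * (5 * ((4 + M) * (n + 1)) ^ 2) *
              Real.exp (Real.pi * √(2 * n / 3)) := by gcongr
          _ = _ := by rw [hK]; ring
      have h2 := Real.log_le_log hpos h1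
      have hn1 : (0 : ℝ) < n + 1 := by positivity
      rw [Real.log_mul (by positivity) (Real.exp_pos _).ne', Real.log_exp,
        Real.log_mul (by positivity) (by positivity), Real.log_pow] at h2
      exact_mod_cast h2
  have hlog0 : ∀ n : ℕ, 0 ≤ Real.log |(c n : ℝ)| := by
    intro n
    rcases eq_or_ne (c n) 0 with h0 | h0
    · simp [h0]
    · refine Real.log_nonneg ?_
      exact_mod_cast Int.one_le_abs h0
  let g : ℕ → ℝ := fun n => (Real.log K / √n + 3 * (Real.log (n + 1) / √n) + Real.pi * √(2 / 3)) ^ 2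
  have hg : Tendsto g atTop (nhds (2 * Real.pi ^ 2 / 3)) := by
    have hsq : Tendsto (fun n : ℕ => √(n : ℝ)) atTop atTop :=
      Real.tendsto_sqrt_atTop.comp tendsto_natCast_atTop_atTop
    have h1 : Tendsto (fun n : ℕ => Real.log K / √(n : ℝ)) atTop (nhds 0) :=
      hsq.const_div_atTop _
    have h2 : Tendsto (fun n : ℕ => Real.log ((n : ℝ) + 1) / √(n : ℝ)) atTop (nhds 0) := by
      have ha : Tendsto (fun n : ℕ => Real.log ((n : ℝ) + 1) / ((n : ℝ) + 1) ^ (1 / 4 : ℝ)) atTop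
          (nhds 0) := by
        have := (isLittleO_log_rpow_atTop (show (0 : ℝ) < 1 / 4 by norm_num)).tendsto_div_nhds_zero
        exact this.comp (tendsto_atTop_add_const_right _ 1 tendsto_natCast_atTop_atTop)
      have hb2 := ha.mul_const 2
      rw [zero_mul] at hb2
      refine squeeze_zero' (Eventually.of_forall fun n => ?_) ?_ hb2
      · have := Real.log_nonneg (show (1 : ℝ) ≤ n + 1 by linarith [Nat.cast_nonneg (α := ℝ) n])
        positivity
      · filter_upwards [eventually_ge_atTop 1] with n hn
        have hn' : (1 : ℝ) ≤ n := by exact_mod_cast hn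
        have hl := Real.log_nonneg (show (1 : ℝ) ≤ n + 1 by linarith)
        rw [div_mul_eq_mul_div, div_le_div_iff₀ (by positivity) (by positivity), mul_assoc]
        refine mul_le_mul_of_nonneg_left ?_ hl
        have e1 : ((n : ℝ) + 1) ^ (1 / 4 : ℝ) ≤ ((n : ℝ) + 1) ^ (1 / 2 : ℝ) :=
          Real.rpow_le_rpow_of_exponent_le (by linarith) (by norm_num)
        rw [← Real.sqrt_eq_rpow] at e1
        refine e1.trans (Real.sqrt_le_iff.mpr ⟨by positivity, ?_⟩)
        rw [mul_pow, Real.sq_sqrt (by positivity)]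
        linarith
    have h3 := ((h1.add (h2.const_mul 3)).add_const (Real.pi * √(2 / 3))).pow 2
    have e : (0 + 3 * 0 + Real.pi * √(2 / 3)) ^ 2 = 2 * Real.pi ^ 2 / 3 := by
      rw [mul_zero, zero_add, zero_add, mul_pow, Real.sq_sqrt (by norm_num)]; ring
    rw [e] at h3
    exact h3
  have hle : (fun n : ℕ => (Real.log |(c n : ℝ)|) ^ 2 / n) ≤ᶠ[atTop] g := by
    filter_upwards [eventually_ge_atTop 1] with n hn
    have hn' : (0 : ℝ) < n := by exact_mod_cast hn
    have hr : 0 < √(n : ℝ) := Real.sqrt_pos.mpr hn'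
    have h1 : (Real.log |(c n : ℝ)|) ^ 2 / n = (Real.log |(c n : ℝ)| / √(n : ℝ)) ^ 2 := by
      rw [div_pow, Real.sq_sqrt hn'.le]
    rw [h1]
    refine pow_le_pow_left₀ (div_nonneg (hlog0 n) hr.le) ?_ 2
    rw [div_le_iff₀ hr]
    refine (hlog n).trans (le_of_eq ?_)
    have : √(2 * (n : ℝ) / 3) = √(2 / 3) * √(n : ℝ) := by
      rw [← Real.sqrt_mul (by norm_num)]; congr 1; ring
    rw [this]; field_simp
  rw [← hg.limsup_eq]
  refine limsup_le_limsup hle ?_ hg.isBoundedUnder_le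
  exact isCoboundedUnder_le_of_le atTop (x := 0) (fun n => by positivity)
end

section
/- Let r ≥ 1 be an integer and let p_r(n) denote the number of partitions of n into parts congruent to 0, r, or r+1 modulo 2r+1. Then (log p_r(n))²/n converges to 2π²/(2r+1) as n → ∞. Equivalently, the effective central charge of the q-series 1/θ(−q^r, −q^{r+1}) = Σ_{n≥0} p_r(n)q^n equals 3/(2r+1). -/
open Filter

/-- `p_r(n)`: the number of partitions of `n` into parts congruent to `0`, `r` or `r+1`
modulo `2r+1`. -/
noncomputable def pr (r n : ℕ) : ℕ :=
  Nat.card {P : Nat.Partition n //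
    ∀ x ∈ P.parts, x % (2 * r + 1) = 0 ∨ x % (2 * r + 1) = r ∨ x % (2 * r + 1) = r + 1}

open PowerSeries in
lemma aux_geom (k : ℕ) (hk : 0 < k) (n : ℕ) :
    letI := PowerSeries.WithPiTopology.instTopologicalSpace ℝ
    PowerSeries.coeff n (∑' j : ℕ, (PowerSeries.X : PowerSeries ℝ) ^ (k * j)) =
      if k ∣ n then 1 else 0 := by
  let _ := PowerSeries.WithPiTopology.instTopologicalSpace ℝ
  have hs : Summable (fun j : ℕ => (PowerSeries.X : PowerSeries ℝ) ^ (k * j)) := by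
    simp_rw [pow_mul]
    exact WithPiTopology.summable_pow_of_constantCoeff_eq_zero (by simp [hk.ne'])
  have h2 := (hs.hasSum.map (PowerSeries.coeff (R := ℝ) n) (WithPiTopology.continuous_coeff ℝ n))
  rw [← h2.tsum_eq]
  simp only [Function.comp_def, PowerSeries.coeff_X_pow]
  split_ifs with h
  · obtain ⟨j, rfl⟩ := h
    rw [tsum_eq_single j]
    · simp
    · intro b hb
      rw [if_neg]
      intro h
      exact hb (Nat.eq_of_mul_eq_mul_left hk h).symm
  · convert tsum_zero with j
    rw [if_neg]
    rintro rfl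
    exact h (dvd_mul_right _ _)

lemma aux_hasSum_mul (f g : PowerSeries ℝ) (x v w : ℝ) (hx : 0 ≤ x)
    (hf : ∀ n, 0 ≤ PowerSeries.coeff n f) (hg : ∀ n, 0 ≤ PowerSeries.coeff n g)
    (hfs : HasSum (fun n => PowerSeries.coeff n f * x ^ n) v)
    (hgs : HasSum (fun n => PowerSeries.coeff n g * x ^ n) w) :
    HasSum (fun n => PowerSeries.coeff n (f * g) * x ^ n) (v * w) := by
  have h1 : Summable (fun n => ‖PowerSeries.coeff n f * x ^ n‖) := by
    convert hfs.summable using 2 with n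
    exact Real.norm_of_nonneg (mul_nonneg (hf n) (pow_nonneg hx n))
  have h2 : Summable (fun n => ‖PowerSeries.coeff n g * x ^ n‖) := by
    convert hgs.summable using 2 with n
    exact Real.norm_of_nonneg (mul_nonneg (hg n) (pow_nonneg hx n))
  have h3 := tsum_mul_tsum_eq_tsum_sum_antidiagonal_of_summable_norm h1 h2
  have h4 := (summable_norm_sum_mul_antidiagonal_of_summable_norm h1 h2).of_norm
  rw [hfs.tsum_eq, hgs.tsum_eq] at h3
  rw [h3]
  have h5 : (fun n => PowerSeries.coeff n (f * g) * x ^ n) = fun n =>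
      ∑ kl ∈ Finset.HasAntidiagonal.antidiagonal n, PowerSeries.coeff kl.1 f * x ^ kl.1 *
        (PowerSeries.coeff kl.2 g * x ^ kl.2) := by
    funext n
    rw [PowerSeries.coeff_mul, Finset.sum_mul]
    refine Finset.sum_congr rfl fun ij hij => ?_
    rw [← Finset.HasAntidiagonal.mem_antidiagonal.1 hij, pow_add]
    ring
  rw [h5]
  exact h4.hasSum

lemma aux_geom_hasSum (k : ℕ) (hk : 0 < k) (x : ℝ) (hx : 0 ≤ x) (hx1 : x < 1) :
    HasSum (fun n : ℕ => (if k ∣ n then (1 : ℝ) else 0) * x ^ n) (1 - x ^ k)⁻¹ := by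
  have h := hasSum_geometric_of_lt_one (pow_nonneg hx k) (pow_lt_one₀ hx hx1 hk.ne')
  have hi : Function.Injective (fun j : ℕ => k * j) := fun a b h => Nat.eq_of_mul_eq_mul_left hk h
  rw [← hi.hasSum_iff]
  · convert h using 2 with j
    simp [pow_mul]
  · intro n hn
    rw [if_neg, zero_mul]
    rintro ⟨j, rfl⟩
    exact hn ⟨j, rfl⟩

open PowerSeries PowerSeries.WithPiTopology in
lemma aux_gen (p : ℕ → Prop) [DecidablePred p] (N : ℕ) (x : ℝ) (hx : 0 ≤ x) (hx1 : x < 1) :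
    HasSum (fun n : ℕ => ((Nat.Partition.restricted n (fun k => p k ∧ k ≤ N)).card : ℝ) * x ^ n)
      (∏ i ∈ Finset.range N, if p (i + 1) then (1 - x ^ (i + 1))⁻¹ else 1) := by
  have h := Nat.Partition.powerSeriesMk_card_restricted_eq_tprod ℝ (fun k => p k ∧ k ≤ N)
  rw [tprod_eq_prod (s := Finset.range N)] at h
  swap
  · intro b hb
    rw [if_neg]
    simp at hb
    omega
  have key : ∀ K ≤ N, (∀ n, 0 ≤ PowerSeries.coeff n (∏ i ∈ Finset.range K,
      if p (i+1) ∧ (i+1) ≤ N then ∑' j : ℕ, (X : ℝ⟦X⟧) ^ ((i + 1) * j) else 1)) ∧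
      HasSum (fun n => PowerSeries.coeff n (∏ i ∈ Finset.range K,
      if p (i+1) ∧ (i+1) ≤ N then ∑' j : ℕ, (X : ℝ⟦X⟧) ^ ((i + 1) * j) else 1) * x ^ n)
      (∏ i ∈ Finset.range K, if p (i + 1) then (1 - x ^ (i + 1))⁻¹ else 1) := by
    intro K
    induction K with
    | zero =>
      intro _
      simp only [Finset.range_zero, Finset.prod_empty, PowerSeries.coeff_one]
      refine ⟨fun n => by split_ifs <;> simp, ?_⟩
      convert hasSum_ite_eq (0 : ℕ) (1 : ℝ) using 2 with n
      split_ifs with h <;> simp [h]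
    | succ K ih =>
      intro hK
      obtain ⟨ih1, ih2⟩ := ih (by omega)
      rw [Finset.prod_range_succ, Finset.prod_range_succ]
      by_cases hp : p (K + 1)
      · rw [if_pos ⟨hp, hK⟩, if_pos hp]
        have hg : ∀ n, 0 ≤ PowerSeries.coeff n (∑' j : ℕ, (X : ℝ⟦X⟧) ^ ((K + 1) * j)) := by
          intro n
          rw [aux_geom _ (Nat.succ_pos K)]
          split_ifs <;> simp
        constructor
        · intro n
          rw [PowerSeries.coeff_mul]
          exact Finset.sum_nonneg fun ij _ => mul_nonneg (ih1 _) (hg _)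
        · apply aux_hasSum_mul _ _ x _ _ hx ih1 hg ih2
          simp_rw [aux_geom _ (Nat.succ_pos K)]
          exact aux_geom_hasSum _ (Nat.succ_pos K) x hx hx1
      · rw [if_neg (fun h => hp h.1), if_neg hp, mul_one, mul_one]
        exact ⟨ih1, ih2⟩
  have h2 := (key N le_rfl).2
  rw [← h] at h2
  simpa using h2

lemma aux_gen_full (p : ℕ → Prop) [DecidablePred p] (x B : ℝ) (hx : 0 ≤ x) (hx1 : x < 1)
    (hB : HasSum (fun i : ℕ => if p (i + 1) then -Real.log (1 - x ^ (i + 1)) else 0) B) :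
    HasSum (fun n : ℕ => ((Nat.Partition.restricted n p).card : ℝ) * x ^ n) (Real.exp B) := by
  have hpos : ∀ i : ℕ, 0 < 1 - x ^ (i + 1) := fun i => by
    have := pow_lt_one₀ hx hx1 (n := i + 1) (Nat.succ_ne_zero i)
    linarith
  have hP : ∀ N, (∏ i ∈ Finset.range N, if p (i + 1) then (1 - x ^ (i + 1))⁻¹ else 1) =
      Real.exp (∑ i ∈ Finset.range N, if p (i + 1) then -Real.log (1 - x ^ (i + 1)) else 0) := by
    intro N
    rw [Real.exp_sum]
    refine Finset.prod_congr rfl fun i _ => ?_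
    split_ifs
    · rw [Real.exp_neg, Real.exp_log (hpos i)]
    · simp
  have hnn : ∀ i : ℕ, 0 ≤ (if p (i + 1) then -Real.log (1 - x ^ (i + 1)) else 0) := by
    intro i
    split_ifs
    · have := Real.log_nonpos (hpos i).le (by linarith [pow_nonneg hx (i + 1)])
      linarith
    · exact le_rfl
  have hle : ∀ N, (∏ i ∈ Finset.range N, if p (i + 1) then (1 - x ^ (i + 1))⁻¹ else 1) ≤
      Real.exp B := by
    intro N
    rw [hP]
    exact Real.exp_le_exp.2 (sum_le_hasSum _ (fun i _ => hnn i) hB)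
  have hpart : ∀ N, ∑ n ∈ Finset.range N, ((Nat.Partition.restricted n p).card : ℝ) * x ^ n ≤
      Real.exp B := by
    intro N
    refine le_trans ?_ (hle N)
    refine le_trans (le_of_eq ?_) (sum_le_hasSum (Finset.range N) (fun n _ => by positivity)
      (aux_gen p N x hx hx1))
    refine Finset.sum_congr rfl fun n hn => ?_
    congr 3
    unfold Nat.Partition.restricted
    refine Finset.filter_congr fun P _ => ?_
    refine forall₂_congr fun i hi => ?_
    have := Multiset.le_sum_of_mem hi
    rw [P.parts_sum] at this
    simp at hn
    constructor
    · exact fun h => ⟨h, by omega⟩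
    · exact fun h => h.1
  have hs : Summable (fun n : ℕ => ((Nat.Partition.restricted n p).card : ℝ) * x ^ n) :=
    summable_of_sum_range_le (fun n => by positivity) hpart
  have heq : ∑' n : ℕ, ((Nat.Partition.restricted n p).card : ℝ) * x ^ n = Real.exp B := by
    apply le_antisymm
    · exact Real.tsum_le_of_sum_range_le (fun n => by positivity) hpart
    · have ht := (Real.continuous_exp.tendsto _).comp hB.tendsto_sum_nat
      refine le_of_tendsto' ht fun N => ?_
      rw [Function.comp_apply, ← hP]
      refine hasSum_le (fun n => ?_) (aux_gen p N x hx hx1) hs.hasSum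
      gcongr
      unfold Nat.Partition.restricted
      intro P hP
      simp only [Finset.mem_filter, Finset.mem_univ, true_and] at hP ⊢
      exact fun i hi => (hP i hi).1
  rw [← heq]
  exact hs.hasSum


lemma aux_window (a : ℕ → ℝ) (ha : ∀ n, 0 ≤ a n) (L : ℝ → ℝ)
    (hF : ∀ t, 0 < t → HasSum (fun n : ℕ => a n * Real.exp (-(n * t))) (Real.exp (L t)))
    (A η t M : ℝ) (m : ℕ) (hη : 0 < η) (hη1 : η < 1) (ht : 0 < t)
    (hM0 : 0 ≤ M) (hM : ∀ k ≤ m, a k ≤ M) (hm : (1 + 2 * η) * A / t ^ 2 ≤ m) :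
    Real.exp (L t) ≤ (m + 1) * (M * Real.exp (-((1 - 2 * η) * A / t))) +
      Real.exp (L ((1 - η) * t) - (1 + 2 * η) * A * η / t) +
      Real.exp (L ((1 + η) * t) + (1 - 2 * η) * A * η / t) := by
  have h1 := hF t ht
  have h2 := (hF ((1 - η) * t) (by apply mul_pos _ ht; linarith)).mul_right
    (Real.exp (-((1 + 2 * η) * A * η / t)))
  have h3 := (hF ((1 + η) * t) (by positivity)).mul_right
    (Real.exp ((1 - 2 * η) * A * η / t))
  have h0 : HasSum (fun k : ℕ => if k ∈ Finset.range (m + 1) then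
      M * Real.exp (-((1 - 2 * η) * A / t)) else 0)
      ((m + 1) * (M * Real.exp (-((1 - 2 * η) * A / t)))) := by
    have := hasSum_sum_of_ne_finset_zero (L := SummationFilter.unconditional ℕ) (s := Finset.range (m + 1))
      (f := fun k : ℕ => if k ∈ Finset.range (m + 1) then
      M * Real.exp (-((1 - 2 * η) * A / t)) else 0) (fun b hb => if_neg hb)
    convert this using 1
    rw [Finset.sum_congr rfl (fun k hk => if_pos hk)]
    simp
  rw [← Real.exp_add, ← sub_eq_add_neg] at h2
  rw [← Real.exp_add] at h3
  refine hasSum_le (fun k => ?_) h1 ((h0.add h2).add h3)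
  have e2 : 0 ≤ a k * Real.exp (-(k * ((1 - η) * t))) * Real.exp (-((1 + 2 * η) * A * η / t)) :=
    mul_nonneg (mul_nonneg (ha k) (Real.exp_pos _).le) (Real.exp_pos _).le
  have e3 : 0 ≤ a k * Real.exp (-(k * ((1 + η) * t))) * Real.exp ((1 - 2 * η) * A * η / t) :=
    mul_nonneg (mul_nonneg (ha k) (Real.exp_pos _).le) (Real.exp_pos _).le
  have e1 : 0 ≤ (if k ∈ Finset.range (m + 1) then
      M * Real.exp (-((1 - 2 * η) * A / t)) else 0) := by
    split_ifs
    · positivity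
    · exact le_rfl
  by_cases hk : k ∈ Finset.range (m + 1)
  · by_cases hk2 : (k : ℝ) < (1 - 2 * η) * A / t ^ 2
    · have : a k * Real.exp (-(k * t)) ≤
        a k * Real.exp (-(k * ((1 + η) * t))) * Real.exp ((1 - 2 * η) * A * η / t) := by
        rw [mul_assoc, ← Real.exp_add]
        refine mul_le_mul_of_nonneg_left (Real.exp_le_exp.2 ?_) (ha k)
        have h5 : (k : ℝ) * (η * t) ≤ (1 - 2 * η) * A / t ^ 2 * (η * t) := by gcongr
        have h6 : (1 - 2 * η) * A / t ^ 2 * (η * t) = (1 - 2 * η) * A * η / t := by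
          field_simp
        linarith
      linarith
    · have : a k * Real.exp (-(k * t)) ≤ M * Real.exp (-((1 - 2 * η) * A / t)) := by
        have hk3 : k ≤ m := by simp at hk; omega
        refine mul_le_mul (hM k hk3) (Real.exp_le_exp.2 ?_) (Real.exp_pos _).le hM0
        have h5 : (1 - 2 * η) * A / t ^ 2 * t ≤ k * t := by
          gcongr; exact not_lt.1 hk2
        have h6 : (1 - 2 * η) * A / t ^ 2 * t = (1 - 2 * η) * A / t := by
          field_simp
        linarith
      rw [if_pos hk]
      linarith
  · have : a k * Real.exp (-(k * t)) ≤
        a k * Real.exp (-(k * ((1 - η) * t))) * Real.exp (-((1 + 2 * η) * A * η / t)) := by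
      rw [mul_assoc, ← Real.exp_add]
      refine mul_le_mul_of_nonneg_left (Real.exp_le_exp.2 ?_) (ha k)
      have hk3 : (m : ℝ) ≤ k := by
        simp at hk
        exact_mod_cast (by omega : m ≤ k)
      have h5 : (1 + 2 * η) * A / t ^ 2 * (η * t) ≤ (k : ℝ) * (η * t) := by
        gcongr; linarith
      have h6 : (1 + 2 * η) * A / t ^ 2 * (η * t) = (1 + 2 * η) * A * η / t := by
        field_simp
      linarith
    linarith

/-- window estimate for small `t`. -/
lemma aux_window2 (a : ℕ → ℝ) (ha : ∀ n, 0 ≤ a n) (L : ℝ → ℝ)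
    (hF : ∀ t, 0 < t → HasSum (fun n : ℕ => a n * Real.exp (-(n * t))) (Real.exp (L t)))
    (A η : ℝ) (hA : 0 < A) (hη : 0 < η) (hη1 : η ≤ 1 / 4)
    (hL : Tendsto (fun t => t * L t) (nhdsWithin 0 (Set.Ioi 0)) (nhds A)) :
    ∀ᶠ t in nhdsWithin 0 (Set.Ioi (0 : ℝ)), ∀ (m : ℕ) (M : ℝ), 0 ≤ M → (∀ k ≤ m, a k ≤ M) →
      (1 + 2 * η) * A / t ^ 2 ≤ m →
      Real.exp ((2 - 3 * η) * (A / t)) ≤ 2 * (m + 1) * M := by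
  set ε := η ^ 2 / 16 with hε
  have hε0 : 0 < ε := by positivity
  have hev : ∀ᶠ t in nhdsWithin 0 (Set.Ioi (0 : ℝ)), |t * L t - A| ≤ ε * A := by
    have := Metric.tendsto_nhds.1 hL (ε * A) (by positivity)
    filter_upwards [this] with t ht
    exact ht.le
  have hsc : ∀ c : ℝ, 0 < c → Tendsto (fun t : ℝ => c * t) (nhdsWithin 0 (Set.Ioi 0))
      (nhdsWithin 0 (Set.Ioi 0)) := by
    intro c hc
    refine tendsto_nhdsWithin_iff.2 ⟨?_, ?_⟩
    · have : Tendsto (fun t : ℝ => c * t) (nhds 0) (nhds (c * 0)) :=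
        (continuous_const.mul continuous_id).tendsto 0
      rw [mul_zero] at this
      exact this.mono_left nhdsWithin_le_nhds
    · filter_upwards [self_mem_nhdsWithin] with t ht
      exact mul_pos hc ht
  have hinv : Tendsto (fun t : ℝ => A / t) (nhdsWithin 0 (Set.Ioi 0)) atTop := by
    simp_rw [div_eq_mul_inv]
    exact tendsto_inv_nhdsGT_zero.const_mul_atTop hA
  filter_upwards [hev, (hsc (1 - η) (by linarith)).eventually hev,
    (hsc (1 + η) (by linarith)).eventually hev, self_mem_nhdsWithin,
    hinv.eventually_ge_atTop (16 / η ^ 2 * Real.log 4)] with t h1 h2 h3 ht hu m M hM0 hM hm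
  have ht : 0 < t := ht
  have hw := aux_window a ha L hF A η t M m hη (by linarith) ht hM0 hM hm
  set u := A / t with hu'
  have hu0 : 0 < u := by positivity
  have hA' : A = u * t := by rw [hu']; field_simp
  rw [abs_le] at h1 h2 h3
  have l1 : (1 - ε) * u ≤ L t := by
    have : t * ((1 - ε) * u) ≤ t * L t := by rw [hA'] at h1; linarith [h1.1]
    exact le_of_mul_le_mul_left this ht
  have l2 : L ((1 - η) * t) * (1 - η) ≤ (1 + ε) * u := by
    have : t * (L ((1 - η) * t) * (1 - η)) ≤ t * ((1 + ε) * u) := by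
      rw [hA'] at h2; linarith [h2.2]
    exact le_of_mul_le_mul_left this ht
  have l3 : L ((1 + η) * t) * (1 + η) ≤ (1 + ε) * u := by
    have : t * (L ((1 + η) * t) * (1 + η)) ≤ t * ((1 + ε) * u) := by
      rw [hA'] at h3; linarith [h3.2]
    exact le_of_mul_le_mul_left this ht
  have hη2 : η ^ 2 ≤ η / 4 := by nlinarith
  have hη3 : η ^ 3 ≤ η ^ 2 / 4 := by nlinarith [sq_nonneg η]
  have hη4 : 0 < η ^ 3 := by positivity
  have m2 : L ((1 - η) * t) ≤ (1 + η + 2 * η ^ 2 - η ^ 2 / 8 - ε) * u := by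
    have : L ((1 - η) * t) * (1 - η) ≤ ((1 + η + 2 * η ^ 2 - η ^ 2 / 8 - ε) * u) * (1 - η) := by
      refine l2.trans ?_
      have h8 : (1 + η + 2 * η ^ 2 - η ^ 2 / 8 - ε) * (1 - η) =
          1 + 13 / 16 * η ^ 2 - 29 / 16 * η ^ 3 := by
        rw [hε]; ring
      have h9 : (1 + ε) ≤ (1 + η + 2 * η ^ 2 - η ^ 2 / 8 - ε) * (1 - η) := by
        rw [h8, hε]; linarith [sq_nonneg η]
      have h10 := mul_le_mul_of_nonneg_right h9 hu0.le
      linarith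
    exact le_of_mul_le_mul_right this (by linarith)
  have m3 : L ((1 + η) * t) ≤ (1 - η + 2 * η ^ 2 - η ^ 2 / 8 - ε) * u := by
    have : L ((1 + η) * t) * (1 + η) ≤ ((1 - η + 2 * η ^ 2 - η ^ 2 / 8 - ε) * u) * (1 + η) := by
      refine l3.trans ?_
      have h8 : (1 - η + 2 * η ^ 2 - η ^ 2 / 8 - ε) * (1 + η) =
          1 + 13 / 16 * η ^ 2 + 29 / 16 * η ^ 3 := by
        rw [hε]; ring
      have h9 : (1 + ε) ≤ (1 - η + 2 * η ^ 2 - η ^ 2 / 8 - ε) * (1 + η) := by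
        rw [h8, hε]; linarith [sq_nonneg η]
      have h10 := mul_le_mul_of_nonneg_right h9 hu0.le
      linarith
    exact le_of_mul_le_mul_right this (by linarith)
  have hlog : Real.log 4 ≤ η ^ 2 / 8 * u := by
    have : η ^ 2 / 16 * (16 / η ^ 2 * Real.log 4) ≤ η ^ 2 / 16 * u := by gcongr
    have h' : η ^ 2 / 16 * (16 / η ^ 2 * Real.log 4) = Real.log 4 := by field_simp
    have : 0 < η ^ 2 / 16 * u := by positivity
    linarith
  have q : ∀ c : ℝ, c ≤ L t - Real.log 4 → Real.exp c ≤ Real.exp (L t) / 4 := by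
    intro c hc
    refine (Real.exp_le_exp.2 hc).trans (le_of_eq ?_)
    rw [Real.exp_sub, Real.exp_log (by norm_num)]
  have t2 := q (L ((1 - η) * t) - (1 + 2 * η) * A * η / t) (by
    have : (1 + 2 * η) * A * η / t = (1 + 2 * η) * η * u := by rw [hu']; ring
    rw [this]
    linarith)
  have t3 := q (L ((1 + η) * t) + (1 - 2 * η) * A * η / t) (by
    have : (1 - 2 * η) * A * η / t = (1 - 2 * η) * η * u := by rw [hu']; ring
    rw [this]
    linarith)
  have f1 : Real.exp (L t) ≤ 2 * (m + 1) * M * Real.exp (-((1 - 2 * η) * A / t)) := by linarith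
  have f2 : (1 - 2 * η) * A / t = (1 - 2 * η) * u := by rw [hu']; ring
  rw [f2, Real.exp_neg, ← div_eq_mul_inv, le_div_iff₀ (Real.exp_pos _), ← Real.exp_add] at f1
  refine (Real.exp_le_exp.2 ?_).trans f1
  have h11 : ε * u ≤ η * u := mul_le_mul_of_nonneg_right (by rw [hε]; linarith) hu0.le
  linarith

lemma aux_tauber (a : ℕ → ℝ) (ha : ∀ n, 0 ≤ a n) (L : ℝ → ℝ)
    (hF : ∀ t, 0 < t → HasSum (fun n : ℕ => a n * Real.exp (-(n * t))) (Real.exp (L t)))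
    (A : ℝ) (hA : 0 < A)
    (hL : Tendsto (fun t => t * L t) (nhdsWithin 0 (Set.Ioi 0)) (nhds A))
    (N0 : ℕ) (hmono : ∀ n N, N0 ≤ N → a n ≤ a (n + N)) :
    Tendsto (fun n : ℕ => Real.log (a n) / Real.sqrt n) atTop (nhds (2 * Real.sqrt A)) := by
  have hsA : 0 < Real.sqrt A := Real.sqrt_pos.2 hA
  have hcast : Tendsto (fun n : ℕ => (n : ℝ)) atTop atTop := tendsto_natCast_atTop_atTop
  have htend : ∀ c : ℝ, 0 < c → Tendsto (fun n : ℕ => Real.sqrt (c / n)) atTop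
      (nhdsWithin 0 (Set.Ioi 0)) := by
    intro c hc
    refine tendsto_nhdsWithin_iff.2 ⟨?_, ?_⟩
    · have h := (Real.continuous_sqrt.tendsto 0).comp (hcast.const_div_atTop c)
      rw [Real.sqrt_zero] at h
      exact h
    · filter_upwards [eventually_gt_atTop 0] with n hn
      have : (0 : ℝ) < n := by exact_mod_cast hn
      exact Real.sqrt_pos.2 (by positivity)
  -- lower bounds
  have hlow : ∀ η : ℝ, 0 < η → η ≤ 1 / 4 → ∀ᶠ n : ℕ in atTop, 0 < a n ∧
      (2 - 3 * η) * Real.sqrt A / Real.sqrt (1 + 2 * η) * Real.sqrt ((n - N0 : ℕ) / n)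
        - Real.log (2 * (n + 1)) / Real.sqrt n ≤ Real.log (a n) / Real.sqrt n := by
    intro η hη hη1
    have hw := aux_window2 a ha L hF A η hA hη hη1 hL
    have h1 := (htend ((1 + 2 * η) * A) (by positivity)).eventually hw
    have h2 : Tendsto (fun n : ℕ => n - N0) atTop atTop := tendsto_sub_atTop_nat N0
    have h3 := h2.eventually h1
    filter_upwards [h3, eventually_gt_atTop N0] with n hn hnN
    set m := n - N0 with hm
    have hm0 : 0 < m := by omega
    have hmn : m ≤ n := by omega
    have hmR : (0 : ℝ) < m := by exact_mod_cast hm0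
    have hnR : (0 : ℝ) < n := by exact_mod_cast (by omega : 0 < n)
    have hc : 0 < (1 + 2 * η) * A := by positivity
    have key := hn m (a n) (ha n) (fun k hk => by
      have := hmono k (n - k) (by omega)
      rwa [show k + (n - k) = n by omega] at this) (by
      rw [Real.sq_sqrt (by positivity)]
      apply le_of_eq
      field_simp)
    have hpos : 0 < a n := by
      by_contra h
      have h0 : a n = 0 := le_antisymm (not_lt.1 h) (ha n)
      rw [h0, mul_zero] at key
      exact absurd key (not_le.2 (Real.exp_pos _))
    refine ⟨hpos, ?_⟩
    have hlog := Real.log_le_log (Real.exp_pos _) key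
    rw [Real.log_exp, Real.log_mul (by positivity) hpos.ne'] at hlog
    have hlog2 : Real.log (2 * (m + 1)) ≤ Real.log (2 * (n + 1)) := by
      apply Real.log_le_log (by positivity)
      have : (m : ℝ) ≤ n := by exact_mod_cast hmn
      linarith
    have hsn : 0 < Real.sqrt n := Real.sqrt_pos.2 hnR
    rw [sub_le_iff_le_add, ← add_div, le_div_iff₀ hsn]
    have e : (2 - 3 * η) * Real.sqrt A / Real.sqrt (1 + 2 * η) * Real.sqrt (m / n) * Real.sqrt n =
        (2 - 3 * η) * (A / Real.sqrt ((1 + 2 * η) * A / m)) := by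
      rw [Real.sqrt_div hmR.le, Real.sqrt_div hc.le, Real.sqrt_mul (by positivity)]
      have h5 : 0 < Real.sqrt (1 + 2 * η) := Real.sqrt_pos.2 (by positivity)
      have h6 : 0 < Real.sqrt m := Real.sqrt_pos.2 hmR
      have h7 : A = Real.sqrt A * Real.sqrt A := (Real.mul_self_sqrt hA.le).symm
      generalize Real.sqrt A = sA at *
      rw [h7]
      field_simp
    rw [e]
    linarith
  have hratio : Tendsto (fun n : ℕ => Real.sqrt (((n - N0 : ℕ) : ℝ) / n)) atTop (nhds 1) := by
    have h1 : Tendsto (fun n : ℕ => 1 - (N0 : ℝ) / n) atTop (nhds (1 - 0)) :=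
      (hcast.const_div_atTop (N0 : ℝ)).const_sub 1
    rw [sub_zero] at h1
    have h2 := (Real.continuous_sqrt.tendsto 1).comp h1
    rw [Real.sqrt_one] at h2
    refine h2.congr' ?_
    filter_upwards [eventually_gt_atTop N0] with n hn
    have hnR : (0 : ℝ) < n := by exact_mod_cast (by omega : 0 < n)
    simp only [Function.comp_apply]
    congr 1
    rw [Nat.cast_sub hn.le]
    field_simp
  have hlogt : Tendsto (fun n : ℕ => Real.log (2 * (n + 1)) / Real.sqrt n) atTop (nhds 0) := by
    have h1 : Tendsto (fun x : ℝ => Real.log x / x ^ (1 / 2 : ℝ)) atTop (nhds 0) :=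
      (isLittleO_log_rpow_atTop (by norm_num)).tendsto_div_nhds_zero
    have h2 : Tendsto (fun x : ℝ => Real.log 4 / x ^ (1 / 2 : ℝ)) atTop (nhds 0) :=
      (tendsto_rpow_atTop (by norm_num)).const_div_atTop _
    have h3 := (h2.add h1).comp hcast
    rw [add_zero] at h3
    refine squeeze_zero' ?_ ?_ h3
    · filter_upwards with n
      exact div_nonneg (Real.log_nonneg (by have : (0 : ℝ) ≤ n := n.cast_nonneg
                                            linarith)) (Real.sqrt_nonneg _)
    · filter_upwards [eventually_ge_atTop 1] with n hn
      have hnR : (1 : ℝ) ≤ n := by exact_mod_cast hn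
      simp only [Function.comp_apply]
      rw [← Real.sqrt_eq_rpow, ← add_div, ← Real.log_mul (by norm_num) (by linarith)]
      refine div_le_div_of_nonneg_right (Real.log_le_log (by positivity) ?_) (Real.sqrt_nonneg _)
      linarith
  rw [tendsto_order]
  constructor
  · intro b hb
    have hc : Tendsto (fun η : ℝ => (2 - 3 * η) * Real.sqrt A / Real.sqrt (1 + 2 * η))
        (nhdsWithin 0 (Set.Ioi 0)) (nhds (2 * Real.sqrt A)) := by
      have : ContinuousAt (fun η : ℝ => (2 - 3 * η) * Real.sqrt A / Real.sqrt (1 + 2 * η)) 0 := by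
        apply ContinuousAt.div
        · fun_prop
        · fun_prop
        · simp
      have h := this.tendsto
      simp only [mul_zero, sub_zero, add_zero, Real.sqrt_one, div_one] at h
      exact h.mono_left nhdsWithin_le_nhds
    have hs : Set.Ioc (0 : ℝ) (1 / 4) ∈ nhdsWithin (0 : ℝ) (Set.Ioi 0) :=
      Ioc_mem_nhdsGT (by norm_num)
    obtain ⟨η, hη1, hη2⟩ := ((Filter.Tendsto.eventually_const_lt hb hc).and hs).exists
    have hl := ((hratio.const_mul ((2 - 3 * η) * Real.sqrt A / Real.sqrt (1 + 2 * η))).sub hlogt)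
    rw [mul_one, sub_zero] at hl
    filter_upwards [Filter.Tendsto.eventually_const_lt hη1 hl, hlow η hη2.1 hη2.2] with n h1 h2
    exact h1.trans_le h2.2
  · intro b hb
    have hu : Tendsto (fun n : ℕ => Real.sqrt A + (Real.sqrt (A / n) * L (Real.sqrt (A / n))) /
        Real.sqrt A) atTop (nhds (2 * Real.sqrt A)) := by
      have := ((hL.comp (htend A hA)).div_const (Real.sqrt A)).const_add (Real.sqrt A)
      rw [Real.div_sqrt, ← two_mul] at this
      exact this
    filter_upwards [Filter.Tendsto.eventually_lt_const hb hu, eventually_gt_atTop 0,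
      hlow (1 / 4) (by norm_num) le_rfl] with n h1 h2 h3
    refine lt_of_le_of_lt ?_ h1
    have hnR : (0 : ℝ) < n := by exact_mod_cast h2
    have hsn : 0 < Real.sqrt n := Real.sqrt_pos.2 hnR
    set t := Real.sqrt (A / n) with ht
    have ht0 : 0 < t := Real.sqrt_pos.2 (by positivity)
    have h4 := le_hasSum (hF t ht0) n (fun k _ => mul_nonneg (ha k) (Real.exp_pos _).le)
    have h5 := Real.log_le_log (mul_pos h3.1 (Real.exp_pos _)) h4
    rw [Real.log_exp, Real.log_mul h3.1.ne' (Real.exp_pos _).ne', Real.log_exp] at h5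
    have h6 : t * Real.sqrt n = Real.sqrt A := by
      rw [ht, Real.sqrt_div hA.le]; field_simp
    rw [div_le_iff₀ hsn]
    have h7 : (Real.sqrt A + t * L t / Real.sqrt A) * Real.sqrt n = n * t + L t := by
      rw [← h6]
      have h8 : (n : ℝ) = Real.sqrt n * Real.sqrt n := (Real.mul_self_sqrt hnR.le).symm
      generalize Real.sqrt n = sn at *
      rw [h8]
      field_simp
    rw [h7]
    linarith

/-- the residue condition -/
def auxS (r x : ℕ) : Prop :=
  x % (2 * r + 1) = 0 ∨ x % (2 * r + 1) = r ∨ x % (2 * r + 1) = r + 1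

noncomputable instance (r : ℕ) : DecidablePred (auxS r) := fun _ => Classical.dec _

/-- exponential sum over the allowed parts -/
noncomputable def auxg (r : ℕ) (x : ℝ) : ℝ :=
  ∑' i : ℕ, if auxS r (i + 1) then Real.exp (-((i + 1 : ℕ) * x)) else 0

lemma auxg_geom (x : ℝ) (hx : 0 < x) :
    HasSum (fun i : ℕ => Real.exp (-((i : ℕ) * x))) (1 - Real.exp (-x))⁻¹ := by
  have := hasSum_geometric_of_lt_one (Real.exp_pos (-x)).le (Real.exp_lt_one_iff.2 (by linarith))
  convert this using 2 with i
  rw [← Real.exp_nat_mul]; ring_nf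

lemma auxg_summable0 (r : ℕ) (x : ℝ) (hx : 0 < x) :
    Summable (fun i : ℕ => if auxS r i then Real.exp (-((i : ℕ) * x)) else 0) := by
  refine Summable.of_nonneg_of_le (fun i => ?_) (fun i => ?_) (auxg_geom x hx).summable
  · split_ifs
    · positivity
    · exact le_rfl
  · split_ifs
    · exact le_rfl
    · positivity

lemma auxg_summable (r : ℕ) (x : ℝ) (hx : 0 < x) :
    Summable (fun i : ℕ => if auxS r (i + 1) then Real.exp (-((i + 1 : ℕ) * x)) else 0) :=
  by
  have h := (summable_nat_add_iff (f := fun i : ℕ => if auxS r i then Real.exp (-((i : ℕ) * x))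
    else 0) 1).2 (auxg_summable0 r x hx)
  exact h

lemma auxg_nonneg (r : ℕ) (x : ℝ) : 0 ≤ auxg r x :=
  tsum_nonneg fun i => by split_ifs <;> positivity

lemma auxg_le (r : ℕ) (x : ℝ) (hx : 0 < x) : x * auxg r x ≤ 1 := by
  have h1 := (hasSum_nat_add_iff' 1).2 (auxg_geom x hx)
  have h2 : auxg r x ≤ (1 - Real.exp (-x))⁻¹ - 1 := by
    refine hasSum_le (fun i => ?_) (auxg_summable r x hx).hasSum (by simpa using h1)
    split_ifs
    · simp
    · positivity
  have hlt : Real.exp (-x) < 1 := Real.exp_lt_one_iff.2 (by linarith)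
  have h3 : (1 - Real.exp (-x))⁻¹ - 1 ≤ x⁻¹ := by
    have e : (1 - Real.exp (-x))⁻¹ - 1 = (Real.exp x - 1)⁻¹ := by
      have h6 : Real.exp x - 1 ≠ 0 := by
        have := Real.add_one_lt_exp hx.ne'
        linarith
      have h7 : 1 - (Real.exp x)⁻¹ ≠ 0 := by rw [← Real.exp_neg]; linarith
      rw [Real.exp_neg]
      have h5 := Real.exp_pos x
      field_simp
      ring
    rw [e]
    apply inv_anti₀ hx
    linarith [Real.add_one_le_exp x]
  calc x * auxg r x ≤ x * x⁻¹ := by gcongr; linarith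
    _ = 1 := by field_simp

lemma auxg_eq (r : ℕ) (x : ℝ) (hx : 0 < x) :
    x * auxg r x = (∑ k ∈ Finset.range (2 * r + 1), if auxS r k then Real.exp (-(k * x)) else 0) *
      (x / (1 - Real.exp (-((2 * r + 1 : ℕ) * x)))) - x := by
  have hs := auxg_summable0 r x hx
  have h1 := hs.sum_add_tsum_nat_add (2 * r + 1)
  have h2 := hs.sum_add_tsum_nat_add 1
  have h3 : ∑' i : ℕ, (if auxS r (i + (2 * r + 1)) then
      Real.exp (-((i + (2 * r + 1) : ℕ) * x)) else 0) = Real.exp (-((2 * r + 1 : ℕ) * x)) *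
      ∑' i : ℕ, (if auxS r i then Real.exp (-((i : ℕ) * x)) else 0) := by
    rw [← tsum_mul_left]
    congr 1
    ext i
    have : auxS r (i + (2 * r + 1)) ↔ auxS r i := by
      unfold auxS; rw [Nat.add_mod_right]
    simp only [this]
    split_ifs
    · rw [← Real.exp_add]; push_cast; ring_nf
    · simp
  rw [h3] at h1
  have h4 : auxS r 0 := by left; simp
  simp only [Finset.range_one, Finset.sum_singleton, h4, if_true] at h2
  change _ + auxg r x = _ at h2
  have hlt : Real.exp (-((2 * r + 1 : ℕ) * x)) < 1 := by
    apply Real.exp_lt_one_iff.2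
    have : (0 : ℝ) < (2 * r + 1 : ℕ) * x := by positivity
    linarith
  simp at h2
  have h5 : 1 - Real.exp (-((2 * r + 1 : ℕ) * x)) ≠ 0 := by linarith
  generalize Real.exp (-((2 * r + 1 : ℕ) * x)) = E at *
  generalize (∑ k ∈ Finset.range (2 * r + 1), if auxS r k then Real.exp (-(k * x)) else 0) = S at *
  rw [← h2] at h1
  have h6 : S = (1 - E) * (1 + auxg r x) := by linarith
  rw [h6]
  field_simp
  ring

lemma auxS_count (r : ℕ) (hr : 1 ≤ r) :
    (∑ k ∈ Finset.range (2 * r + 1), if auxS r k then (1 : ℝ) else 0) = 3 := by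
  rw [Finset.sum_boole]
  have : Finset.filter (auxS r) (Finset.range (2 * r + 1)) = {0, r, r + 1} := by
    ext k
    simp only [Finset.mem_filter, Finset.mem_range, Finset.mem_insert, Finset.mem_singleton, auxS]
    constructor
    · rintro ⟨h, h2⟩
      rwa [Nat.mod_eq_of_lt h] at h2
    · intro h
      have h3 : k < 2 * r + 1 := by omega
      rw [Nat.mod_eq_of_lt h3]
      exact ⟨h3, h⟩
  rw [this, Finset.card_insert_of_notMem, Finset.card_insert_of_notMem]
  · norm_num
  · simp
  · simp; omega

lemma aux_div_exp (m : ℝ) (hm : 0 < m) :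
    Tendsto (fun x : ℝ => x / (1 - Real.exp (-(m * x)))) (nhdsWithin 0 (Set.Ioi 0))
      (nhds (1 / m)) := by
  have hd : HasDerivAt (fun x : ℝ => 1 - Real.exp (-(m * x))) m 0 := by
    have h := ((((hasDerivAt_id (0 : ℝ)).const_mul m).neg).exp).const_sub 1
    simpa using h
  have h1 := hd.tendsto_slope_zero_right
  have h2 := h1.inv₀ hm.ne'
  rw [one_div]
  refine h2.congr fun x => ?_
  simp [div_eq_mul_inv, mul_comm]

lemma auxg_tendsto (r : ℕ) (hr : 1 ≤ r) :
    Tendsto (fun x => x * auxg r x) (nhdsWithin 0 (Set.Ioi 0)) (nhds (3 / (2 * r + 1))) := by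
  have h1 := aux_div_exp ((2 * r + 1 : ℕ) : ℝ) (by positivity)
  have h2 : Tendsto (fun x : ℝ => ∑ k ∈ Finset.range (2 * r + 1),
      if auxS r k then Real.exp (-(k * x)) else 0) (nhdsWithin 0 (Set.Ioi 0)) (nhds 3) := by
    rw [← auxS_count r hr]
    apply tendsto_finsetSum
    intro k _
    split_ifs
    · have : Continuous (fun x : ℝ => Real.exp (-(k * x))) := by fun_prop
      have h := this.tendsto 0
      simp only [mul_zero, neg_zero, Real.exp_zero] at h
      exact h.mono_left nhdsWithin_le_nhds
    · exact tendsto_const_nhds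
  have h3 : Tendsto (fun x : ℝ => x) (nhdsWithin 0 (Set.Ioi 0)) (nhds 0) :=
    nhdsWithin_le_nhds
  have h4 := (h2.mul h1).sub h3
  have e : (3 : ℝ) * (1 / ((2 * r + 1 : ℕ) : ℝ)) - 0 = 3 / (2 * r + 1) := by
    push_cast; ring
  rw [e] at h4
  refine h4.congr' ?_
  filter_upwards [self_mem_nhdsWithin] with x hx
  exact (auxg_eq r x hx).symm

/-- log of the product -/
noncomputable def auxL (r : ℕ) (t : ℝ) : ℝ := ∑' j : ℕ, auxg r ((j + 1 : ℕ) * t) / (j + 1)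

lemma auxL_term (r : ℕ) (t : ℝ) (ht : 0 < t) (j : ℕ) :
    t * (auxg r ((j + 1 : ℕ) * t) / (j + 1)) =
      (((j + 1 : ℕ) * t) * auxg r ((j + 1 : ℕ) * t)) * (1 / ((j + 1 : ℕ) : ℝ) ^ 2) := by
  push_cast
  field_simp

lemma aux_zeta : HasSum (fun j : ℕ => 1 / ((j + 1 : ℕ) : ℝ) ^ 2) (Real.pi ^ 2 / 6) := by
  have := (hasSum_nat_add_iff' 1).2 hasSum_zeta_two
  simpa using this

lemma auxL_summable (r : ℕ) (t : ℝ) (ht : 0 < t) :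
    Summable (fun j : ℕ => auxg r ((j + 1 : ℕ) * t) / (j + 1)) := by
  have h : Summable (fun j : ℕ => t * (auxg r ((j + 1 : ℕ) * t) / (j + 1))) := by
    refine Summable.of_nonneg_of_le (fun j => ?_) (fun j => ?_) aux_zeta.summable
    · have := auxg_nonneg r ((j + 1 : ℕ) * t)
      positivity
    · rw [auxL_term r t ht]
      have := auxg_le r ((j + 1 : ℕ) * t) (by positivity)
      exact mul_le_of_le_one_left (by positivity) this
  exact (summable_mul_left_iff ht.ne').1 h

lemma auxL_tendsto (r : ℕ) (hr : 1 ≤ r) :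
    Tendsto (fun t => t * auxL r t) (nhdsWithin 0 (Set.Ioi 0))
      (nhds (Real.pi ^ 2 / (2 * (2 * r + 1)))) := by
  have e : Real.pi ^ 2 / (2 * (2 * (r : ℝ) + 1)) =
      ∑' j : ℕ, 3 / (2 * (r : ℝ) + 1) * (1 / ((j + 1 : ℕ) : ℝ) ^ 2) := by
    rw [tsum_mul_left, aux_zeta.tsum_eq]
    field_simp
    norm_num
  rw [e]
  have h : Tendsto (fun t : ℝ => ∑' j : ℕ,
      (((j + 1 : ℕ) * t) * auxg r ((j + 1 : ℕ) * t)) * (1 / ((j + 1 : ℕ) : ℝ) ^ 2))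
      (nhdsWithin 0 (Set.Ioi 0))
      (nhds (∑' j : ℕ, 3 / (2 * (r : ℝ) + 1) * (1 / ((j + 1 : ℕ) : ℝ) ^ 2))) := by
    refine tendsto_tsum_of_dominated_convergence aux_zeta.summable (fun j => ?_) ?_
    · refine Tendsto.mul_const _ ?_
      refine (auxg_tendsto r hr).comp (f := fun t : ℝ => ((j + 1 : ℕ) : ℝ) * t) ?_
      refine tendsto_nhdsWithin_iff.2 ⟨?_, ?_⟩
      · have : Continuous (fun t : ℝ => ((j + 1 : ℕ) : ℝ) * t) := by fun_prop
        have h := this.tendsto 0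
        rw [mul_zero] at h
        exact h.mono_left nhdsWithin_le_nhds
      · filter_upwards [self_mem_nhdsWithin] with t ht
        have ht : 0 < t := ht
        exact Set.mem_Ioi.2 (by positivity)
    · filter_upwards [self_mem_nhdsWithin] with t ht j
      have ht : 0 < t := ht
      have h0 : 0 < ((j + 1 : ℕ) : ℝ) * t := by positivity
      have h1 := auxg_le r _ h0
      have h2 := auxg_nonneg r (((j + 1 : ℕ) : ℝ) * t)
      rw [Real.norm_of_nonneg (by positivity)]
      exact mul_le_of_le_one_left (by positivity) h1
  refine h.congr' ?_
  filter_upwards [self_mem_nhdsWithin] with t ht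
  rw [auxL, ← tsum_mul_left]
  exact tsum_congr fun j => (auxL_term r t ht j).symm

lemma auxL_hasSum (r : ℕ) (t : ℝ) (ht : 0 < t) :
    HasSum (fun i : ℕ => if auxS r (i + 1) then
      -Real.log (1 - Real.exp (-t) ^ (i + 1)) else 0) (auxL r t) := by
  let f : ℕ × ℕ → ℝ := fun q => if auxS r (q.2 + 1) then
    Real.exp (-((q.2 + 1 : ℕ) * ((q.1 + 1 : ℕ) * t))) / (q.1 + 1) else 0
  have hf0 : 0 ≤ f := fun q => by
    simp only [f, Pi.zero_apply]
    split_ifs <;> positivity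
  have hrow : ∀ j : ℕ, HasSum (fun i => f (j, i)) (auxg r ((j + 1 : ℕ) * t) / (j + 1)) := by
    intro j
    have := (auxg_summable r ((j + 1 : ℕ) * t) (by positivity)).hasSum.div_const ((j : ℝ) + 1)
    have e : (fun i => f (j, i)) = fun i : ℕ => (if auxS r (i + 1) then
        Real.exp (-((i + 1 : ℕ) * ((j + 1 : ℕ) * t))) else 0) / ((j : ℝ) + 1) := by
      funext i
      change (if auxS r (i + 1) then _ else _) = _
      split_ifs <;> simp
    rw [e]
    exact this
  have hsum : Summable f := by
    refine (summable_prod_of_nonneg hf0).2 ⟨fun j => (hrow j).summable, ?_⟩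
    refine (auxL_summable r t ht).congr fun j => ?_
    exact (hrow j).tsum_eq.symm
  have htot : HasSum f (auxL r t) := by
    have h1 := hsum.hasSum.prod_fiberwise hrow
    rw [auxL, h1.tsum_eq]
    exact hsum.hasSum
  have hswap : HasSum (fun q : ℕ × ℕ => f q.swap) (auxL r t) :=
    (Equiv.prodComm ℕ ℕ).hasSum_iff.2 htot
  refine hswap.prod_fiberwise fun i => ?_
  simp only [f, Prod.swap_prod_mk]
  split_ifs
  · have hx1 : Real.exp (-t) < 1 := Real.exp_lt_one_iff.2 (by linarith)
    have h := Real.hasSum_pow_div_log_of_abs_lt_one (x := Real.exp (-t) ^ (i + 1)) (by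
      rw [abs_of_nonneg (by positivity)]
      exact pow_lt_one₀ (by positivity) hx1 (by omega))
    convert h using 2 with j
    rw [← pow_mul, ← Real.exp_nat_mul]
    push_cast
    ring_nf
  · exact hasSum_zero

lemma aux_pr (r n : ℕ) : pr r n = (Nat.Partition.restricted n (auxS r)).card := by
  unfold pr Nat.Partition.restricted
  rw [Nat.card_eq_fintype_card, Fintype.card_subtype]
  congr 1
  ext P
  rw [Finset.mem_filter, Finset.mem_filter]
  rfl

lemma aux_step (r n k : ℕ) (hk : 0 < k) (hS : auxS r k) : pr r n ≤ pr r (n + k) := by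
  unfold pr
  let F : {P : Nat.Partition n //
    ∀ x ∈ P.parts, x % (2 * r + 1) = 0 ∨ x % (2 * r + 1) = r ∨ x % (2 * r + 1) = r + 1} →
    {P : Nat.Partition (n + k) //
    ∀ x ∈ P.parts, x % (2 * r + 1) = 0 ∨ x % (2 * r + 1) = r ∨ x % (2 * r + 1) = r + 1} :=
    fun P => ⟨⟨k ::ₘ P.1.parts, by
      intro i hi
      rcases Multiset.mem_cons.1 hi with rfl | h
      · exact hk
      · exact P.1.parts_pos h, by
      rw [Multiset.sum_cons, P.1.parts_sum, add_comm]⟩, by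
      intro x hx
      rcases Multiset.mem_cons.1 hx with rfl | h
      · exact hS
      · exact P.2 x h⟩
  refine Nat.card_le_card_of_injective F ?_
  intro P Q h
  have h1 := congrArg (fun R => R.1.parts) h
  have h2 : P.1.parts = Q.1.parts := (Multiset.cons_inj_right k).1 h1
  exact Subtype.ext (Nat.Partition.ext h2)

lemma aux_steps (r n k : ℕ) (hk : 0 < k) (hS : auxS r k) (a : ℕ) :
    pr r n ≤ pr r (n + a * k) := by
  induction a with
  | zero => simp
  | succ a ih =>
    refine ih.trans ((aux_step r (n + a * k) k hk hS).trans (le_of_eq ?_))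
    congr 1
    ring

lemma aux_mono (r : ℕ) (hr : 1 ≤ r) (n N : ℕ) (hN : r * r ≤ N) : pr r n ≤ pr r (n + N) := by
  have h1 : auxS r r := by right; left; exact Nat.mod_eq_of_lt (by omega)
  have h2 : auxS r (r + 1) := by right; right; exact Nat.mod_eq_of_lt (by omega)
  have hq : r ≤ N / r := (Nat.le_div_iff_mul_le (by omega)).2 hN
  have hs : N % r < r := Nat.mod_lt _ (by omega)
  have hd := Nat.div_add_mod N r
  refine (aux_steps r n r (by omega) h1 (N / r - N % r)).trans
    ((aux_steps r _ (r + 1) (by omega) h2 (N % r)).trans (le_of_eq ?_))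
  congr 1
  obtain ⟨d, hd'⟩ := Nat.exists_eq_add_of_le (hs.le.trans hq)
  rw [hd'] at hd ⊢
  rw [Nat.add_sub_cancel_left]
  generalize N % r = s at *
  rw [← hd]
  ring

/-- `(log p_r(n))²/n → 2π²/(2r+1)`, i.e. the effective central charge of
`1/θ(−q^r, −q^{r+1}) = ∑ p_r(n) qⁿ` equals `3/(2r+1)`. -/
theorem stmt9 (r : ℕ) (hr : 1 ≤ r) :
    Tendsto (fun n : ℕ => (Real.log (pr r n)) ^ 2 / n) atTop
      (nhds (2 * Real.pi ^ 2 / (2 * (r : ℝ) + 1))) ∧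
    (3 / (2 * Real.pi ^ 2)) *
        limsup (fun n : ℕ => (Real.log (pr r n)) ^ 2 / n) atTop = 3 / (2 * (r : ℝ) + 1) := by
  have hA : 0 < Real.pi ^ 2 / (2 * (2 * (r : ℝ) + 1)) := by positivity
  have hmain := aux_tauber (fun n => (pr r n : ℝ)) (fun n => Nat.cast_nonneg _) (auxL r)
    (by
      intro t ht
      have h := aux_gen_full (auxS r) (Real.exp (-t)) (auxL r t) (Real.exp_pos _).le
        (Real.exp_lt_one_iff.2 (by linarith)) (auxL_hasSum r t ht)
      have e : (fun n : ℕ => (pr r n : ℝ) * Real.exp (-(n * t))) = fun n : ℕ =>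
          ((Nat.Partition.restricted n (auxS r)).card : ℝ) * Real.exp (-t) ^ n := by
        funext n
        rw [aux_pr, ← Real.exp_nat_mul]
        ring_nf
      rw [e]
      exact h)
    _ hA (auxL_tendsto r hr) (r * r) (fun n N hN => by exact_mod_cast aux_mono r hr n N hN)
  have ht : Tendsto (fun n : ℕ => (Real.log (pr r n)) ^ 2 / n) atTop
      (nhds (2 * Real.pi ^ 2 / (2 * (r : ℝ) + 1))) := by
    have h := hmain.pow 2
    have e : (2 * Real.sqrt (Real.pi ^ 2 / (2 * (2 * (r : ℝ) + 1)))) ^ 2 =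
        2 * Real.pi ^ 2 / (2 * (r : ℝ) + 1) := by
      rw [mul_pow, Real.sq_sqrt hA.le]
      field_simp
    rw [e] at h
    refine h.congr fun n => ?_
    rw [div_pow, Real.sq_sqrt (Nat.cast_nonneg n)]
  refine ⟨ht, ?_⟩
  rw [ht.limsup_eq]
  have := Real.pi_pos
  field_simp
end

section
/- Let s ≥ 1, let M be a symmetric s×s integer matrix that is negative definite (as a real matrix), let a ∈ ℤ^s, and let deg : {1,…,s} → ℕ be a function with η := max_v deg(v) ≥ 3 (the degree sequence of a plumbing tree with framing matrix M having at least one vertex of degree greater than two). Define χ_a(x) = −(xᵀMx + xᵀa)/2, D_j = {x ∈ ℤ^s : 2χ_a(x) = j}, and for j ∈ ℕ set c_j = Σ_{x ∈ D_j} Π_{v=1}^{s} F̂_{deg(v)}((2Mx + a)_v) ∈ ℚ. Then there exists a constant C > 0 such that |c_j| ≤ C·(1+j)^{(η−1)s} for all j ∈ ℕ; that is, the coefficients of the Ẑ-invariant q-series of a negative definite plumbed manifold are bounded above by a polynomial in j of degree (η−1)s. -/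
open Matrix

/-- The weights `F̂_n(k)` of the `Ẑ`-invariant of a negative definite plumbed manifold. -/
def Fhat (n : ℕ) (k : ℤ) : ℚ :=
  if (n = 0 ∧ (k = -2 ∨ k = 2)) ∨ (n = 1 ∧ k = -1) ∨ (n = 2 ∧ k = 0) then 1
  else if n = 0 ∧ k = 0 then -2
  else if n = 1 ∧ k = 1 then -1
  else if 3 ≤ n ∧ (n : ℤ) - 2 ≤ |k| ∧ k % 2 = (n : ℤ) % 2 then
    (1 / 2) * ((k.sign : ℚ)) ^ n * (Nat.choose ((n + k.natAbs) / 2 - 2) (n - 3) : ℚ)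
  else 0

lemma Fhat_abs_le (η : ℕ) (hη : 3 ≤ η) (n : ℕ) (hn : n ≤ η) (k : ℤ) :
    |Fhat n k| ≤ 2 * ((η + k.natAbs : ℕ) : ℚ) ^ (η - 3) := by
  have h1 : (1 : ℚ) ≤ ((η + k.natAbs : ℕ) : ℚ) := by
    exact_mod_cast (by omega : 1 ≤ η + k.natAbs)
  have h2 : (1 : ℚ) ≤ ((η + k.natAbs : ℕ) : ℚ) ^ (η - 3) := one_le_pow₀ h1
  unfold Fhat
  split_ifs with h3 h4 h5 h6
  · rw [abs_one]; linarith
  · rw [abs_neg, abs_two]; linarith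
  · rw [abs_neg, abs_one]; linarith
  · rw [abs_mul, abs_mul, abs_pow]
    have hs : |(k.sign : ℚ)| ^ n ≤ 1 := by
      apply pow_le_one₀ (abs_nonneg _)
      rcases lt_trichotomy k 0 with h | h | h
      · simp [Int.sign_eq_neg_one_of_neg h]
      · simp [h]
      · simp [Int.sign_eq_one_of_pos h]
    have hch : (Nat.choose ((n + k.natAbs) / 2 - 2) (n - 3) : ℚ)
        ≤ ((η + k.natAbs : ℕ) : ℚ) ^ (η - 3) := by
      have : Nat.choose ((n + k.natAbs) / 2 - 2) (n - 3) ≤ (η + k.natAbs) ^ (η - 3) :=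
        calc _ ≤ ((n + k.natAbs) / 2 - 2) ^ (n - 3) := Nat.choose_le_pow _ _
          _ ≤ (η + k.natAbs) ^ (n - 3) := Nat.pow_le_pow_left (by omega) _
          _ ≤ _ := Nat.pow_le_pow_right (by omega) (by omega)
      exact_mod_cast this
    rw [Nat.abs_cast]
    have h12 : |(1/2 : ℚ)| = 1/2 := by norm_num
    rw [h12]
    have h0 : (0:ℚ) ≤ |(k.sign : ℚ)| ^ n := by positivity
    have hc0 : (0:ℚ) ≤ (Nat.choose ((n + k.natAbs) / 2 - 2) (n - 3) : ℚ) := by positivity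
    nlinarith [mul_le_mul_of_nonneg_right hs hc0]
  · rw [abs_zero]; linarith

lemma coercive (s : ℕ) (M : Matrix (Fin s) (Fin s) ℝ)
    (hneg : ∀ x : Fin s → ℝ, x ≠ 0 → x ⬝ᵥ (M *ᵥ x) < 0) :
    ∃ ε : ℝ, 0 < ε ∧ ∀ x : Fin s → ℝ, ε * ‖x‖ ^ 2 ≤ -(x ⬝ᵥ (M *ᵥ x)) := by
  have hcont : Continuous fun x : Fin s → ℝ => -(x ⬝ᵥ (M *ᵥ x)) := by
    fun_prop
  have hK : IsCompact (Metric.sphere (0 : Fin s → ℝ) 1) := isCompact_sphere _ _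
  have key : ∃ ε : ℝ, 0 < ε ∧ ∀ x ∈ Metric.sphere (0 : Fin s → ℝ) 1,
      ε ≤ -(x ⬝ᵥ (M *ᵥ x)) := by
    rcases (Metric.sphere (0 : Fin s → ℝ) 1).eq_empty_or_nonempty with h | h
    · exact ⟨1, one_pos, by simp [h]⟩
    · obtain ⟨y, hy, hmin⟩ := hK.exists_isMinOn h hcont.continuousOn
      refine ⟨_, ?_, fun x hx => hmin hx⟩
      have : y ≠ 0 := by
        rintro rfl
        simp at hy
      have := hneg y this
      simpa using this
  obtain ⟨ε, hε, h⟩ := key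
  refine ⟨ε, hε, fun x => ?_⟩
  by_cases hx : x = 0
  · simp [hx]
  have hnx : 0 < ‖x‖ := norm_pos_iff.mpr hx
  have h1 := h (‖x‖⁻¹ • x) (by simp [norm_smul, hnx.ne'])
  rw [Matrix.mulVec_smul, smul_dotProduct, dotProduct_smul, smul_eq_mul, smul_eq_mul] at h1
  have h2 : ‖x‖⁻¹ * (‖x‖⁻¹ * (x ⬝ᵥ (M *ᵥ x))) * ‖x‖ ^ 2 = x ⬝ᵥ (M *ᵥ x) := by
    field_simp
  nlinarith [mul_le_mul_of_nonneg_right h1 (sq_nonneg ‖x‖)]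

lemma box_bound (s : ℕ) (M : Matrix (Fin s) (Fin s) ℤ)
    (hneg : ∀ x : Fin s → ℝ, x ≠ 0 → x ⬝ᵥ ((M.map ((↑) : ℤ → ℝ)) *ᵥ x) < 0)
    (a : Fin s → ℤ) :
    ∃ B : ℕ, 1 ≤ B ∧ ∀ (j : ℕ) (x : Fin s → ℤ), -(x ⬝ᵥ (M *ᵥ x) + x ⬝ᵥ a) = (j : ℤ) →
      ∀ i, |x i| ≤ ((B * (1 + j) : ℕ) : ℤ) := by
  obtain ⟨ε, hε, h⟩ := coercive s _ hneg
  set A : ℝ := ∑ i, |(a i : ℝ)| with hA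
  have hA0 : 0 ≤ A := Finset.sum_nonneg fun i _ => abs_nonneg _
  obtain ⟨B, hB⟩ := exists_nat_ge (1 + (1 + A) / ε)
  have hq : 0 ≤ (1 + A) / ε := by positivity
  refine ⟨B, by exact_mod_cast (by linarith : (1:ℝ) ≤ B), fun j x hx i => ?_⟩
  set y : Fin s → ℝ := fun i => (x i : ℝ) with hy
  have hx' : -(y ⬝ᵥ ((M.map ((↑) : ℤ → ℝ)) *ᵥ y) + y ⬝ᵥ fun i => (a i : ℝ)) = (j : ℝ) := by
    have := congrArg (fun z : ℤ => (z : ℝ)) hx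
    simp only [dotProduct, mulVec] at this
    push_cast at this
    simpa [dotProduct, mulVec, hy] using this
  have hya : |y ⬝ᵥ fun i => (a i : ℝ)| ≤ A * ‖y‖ := by
    rw [dotProduct, hA, Finset.sum_mul]
    refine (Finset.abs_sum_le_sum_abs _ _).trans (Finset.sum_le_sum fun i _ => ?_)
    rw [abs_mul, mul_comm]
    exact mul_le_mul_of_nonneg_left (norm_le_pi_norm y i) (abs_nonneg _)
  have h1 := h y
  have h2 : ε * ‖y‖ ^ 2 ≤ j + A * ‖y‖ := by
    have := (abs_le.mp hya).1
    have := neg_abs_le (y ⬝ᵥ fun i => (a i : ℝ))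
    have := le_abs_self (y ⬝ᵥ fun i => (a i : ℝ))
    linarith
  have hj : (0:ℝ) ≤ j := Nat.cast_nonneg j
  have h3 : ‖y‖ ≤ B * (1 + j) := by
    by_cases hy1 : ‖y‖ ≤ 1
    · nlinarith
    · push Not at hy1
      have h4 : ε * ‖y‖ ≤ j + A := by
        by_contra hcon
        push Not at hcon
        nlinarith [mul_lt_mul_of_pos_right hcon (by linarith : 0 < ‖y‖)]
      have h5 : ‖y‖ ≤ (j + A) / ε := by
        rw [le_div_iff₀ hε]; linarith
      have h6 : (j + A) / ε ≤ (1 + A) / ε * (1 + j) := by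
        rw [div_mul_eq_mul_div]
        apply div_le_div_of_nonneg_right _ hε.le
        nlinarith
      nlinarith
  have h7 : |y i| ≤ B * (1 + j) := (norm_le_pi_norm y i).trans h3
  simp only [hy] at h7
  exact_mod_cast h7

/-- The coefficients
`c_j = ∑_{x ∈ D_j} ∏_v F̂_{deg v}((2Mx+a)_v)` of the `Ẑ`-invariant of a negative definite
plumbed manifold with maximal vertex degree `η ≥ 3` are bounded above by a polynomial in `j`
of degree `(η−1)s`. -/
theorem stmt12 (s : ℕ) (hs : 1 ≤ s) (M : Matrix (Fin s) (Fin s) ℤ)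
    (hsymm : M.IsSymm)
    (hneg : ∀ x : Fin s → ℝ, x ≠ 0 → x ⬝ᵥ ((M.map ((↑) : ℤ → ℝ)) *ᵥ x) < 0)
    (a : Fin s → ℤ) (deg : Fin s → ℕ) (η : ℕ) (hη : 3 ≤ η)
    (hηmax : ∀ v, deg v ≤ η) (hηmem : ∃ v, deg v = η)
    (c : ℕ → ℚ)
    (hc : ∀ j : ℕ, c j =
      ∑ᶠ x ∈ {x : Fin s → ℤ | -(x ⬝ᵥ (M *ᵥ x) + x ⬝ᵥ a) = (j : ℤ)},
        ∏ v : Fin s, Fhat (deg v) (2 * (M *ᵥ x) v + a v)) :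
    ∃ C : ℚ, 0 < C ∧ ∀ j : ℕ, |c j| ≤ C * ((1 : ℚ) + (j : ℚ)) ^ ((η - 1) * s) := by
  obtain ⟨B, hB1, hB⟩ := box_bound s M hneg a
  -- a uniform bound for the arguments of the weights
  set S : ℕ := ∑ v, ∑ i, (M v i).natAbs with hS
  set T : ℕ := ∑ v, (a v).natAbs with hT
  set E : ℕ := η + 2 * S * B + T with hE
  have hE0 : 0 < E := by omega
  refine ⟨(3 * B : ℚ) ^ s * (2 * (E : ℚ) ^ (η - 3)) ^ s, by positivity, fun j => ?_⟩
  set N : ℕ := B * (1 + j) with hN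
  have hN1 : 1 ≤ N := Nat.mul_pos hB1 (by omega)
  have harg : ∀ x : Fin s → ℤ, -(x ⬝ᵥ (M *ᵥ x) + x ⬝ᵥ a) = (j : ℤ) → ∀ v,
      η + (2 * (M *ᵥ x) v + a v).natAbs ≤ E * (1 + j) := by
    intro x hx v
    have h1 : ((M *ᵥ x) v).natAbs ≤ S * N := by
      calc ((M *ᵥ x) v).natAbs ≤ ∑ i, (M v i * x i).natAbs := by
            zify
            simp only [mulVec, dotProduct]
            exact Finset.abs_sum_le_sum_abs _ _
        _ ≤ ∑ i, (M v i).natAbs * N := by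
            refine Finset.sum_le_sum fun i _ => ?_
            rw [Int.natAbs_mul]
            refine Nat.mul_le_mul_left _ ?_
            have := hB j x hx i
            zify
            exact_mod_cast this
        _ = (∑ i, (M v i).natAbs) * N := by rw [Finset.sum_mul]
        _ ≤ S * N := Nat.mul_le_mul_right _
            (Finset.single_le_sum (f := fun v => ∑ i, (M v i).natAbs)
              (fun _ _ => Nat.zero_le _) (Finset.mem_univ v))
    have h2 : (a v).natAbs ≤ T := Finset.single_le_sum (f := fun v => (a v).natAbs)
              (fun _ _ => Nat.zero_le _) (Finset.mem_univ v)
    have h3 : (2 * (M *ᵥ x) v + a v).natAbs ≤ 2 * (S * N) + T := by omega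
    have h4 : E * (1 + j) = η + T + (η + T) * j + 2 * (S * N) := by rw [hE, hN]; ring
    have h5 : 0 ≤ (η + T) * j := Nat.zero_le _
    omega
  have hterm : ∀ x : Fin s → ℤ, -(x ⬝ᵥ (M *ᵥ x) + x ⬝ᵥ a) = (j : ℤ) →
      |∏ v : Fin s, Fhat (deg v) (2 * (M *ᵥ x) v + a v)|
        ≤ (2 * ((E : ℚ) * (1 + j)) ^ (η - 3)) ^ s := by
    intro x hx
    rw [Finset.abs_prod]
    calc _ ≤ ∏ v : Fin s, (2 * ((E : ℚ) * (1 + j)) ^ (η - 3)) := by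
          refine Finset.prod_le_prod (fun _ _ => abs_nonneg _) fun v _ => ?_
          refine (Fhat_abs_le η hη _ (hηmax v) _).trans ?_
          have : ((η + (2 * (M *ᵥ x) v + a v).natAbs : ℕ) : ℚ) ≤ (E : ℚ) * (1 + j) := by
            exact_mod_cast harg x hx v
          gcongr
      _ = _ := by simp
  set box : Finset (Fin s → ℤ) := Fintype.piFinset fun _ => Finset.Icc (-(N : ℤ)) N with hbox
  have hsub : {x : Fin s → ℤ | -(x ⬝ᵥ (M *ᵥ x) + x ⬝ᵥ a) = (j : ℤ)} ⊆ ↑box := by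
    intro x hx
    simp only [hbox, Finset.mem_coe, Fintype.mem_piFinset, Finset.mem_Icc]
    exact fun i => abs_le.mp (hB j x hx i)
  have hfin := box.finite_toSet.subset hsub
  have hcard : (hfin.toFinset.card : ℚ) ≤ (3 * B * (1 + j)) ^ s := by
    have h1 : hfin.toFinset.card ≤ box.card :=
      Finset.card_le_card (by simpa using hsub)
    have h2 : box.card = (2 * N + 1) ^ s := by
      simp only [hbox, Fintype.card_piFinset, Int.card_Icc, Finset.prod_const, Finset.card_univ,
        Fintype.card_fin]
      congr 1
      omega
    have h3 : (2 * N + 1) ^ s ≤ (3 * B * (1 + j)) ^ s :=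
      Nat.pow_le_pow_left (by rw [mul_assoc]; omega) _
    exact_mod_cast (h1.trans (h2.le.trans h3))
  rw [hc j, finsum_mem_eq_finite_toFinset_sum _ hfin]
  have hj1 : (1 : ℚ) ≤ 1 + j := by
    have : (0:ℚ) ≤ j := Nat.cast_nonneg j
    linarith
  calc _ ≤ ∑ x ∈ hfin.toFinset, |∏ v : Fin s, Fhat (deg v) (2 * (M *ᵥ x) v + a v)| :=
        Finset.abs_sum_le_sum_abs _ _
    _ ≤ hfin.toFinset.card • (2 * ((E : ℚ) * (1 + j)) ^ (η - 3)) ^ s :=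
        Finset.sum_le_card_nsmul _ _ _ fun x hx => hterm x (by simpa using hx)
    _ ≤ (3 * B * (1 + j)) ^ s * (2 * ((E : ℚ) * (1 + j)) ^ (η - 3)) ^ s := by
        rw [nsmul_eq_mul]
        gcongr
    _ = (3 * B : ℚ) ^ s * (2 * (E : ℚ) ^ (η - 3)) ^ s * (1 + (j : ℚ)) ^ ((η - 2) * s) := by
        have : η - 2 = (η - 3) + 1 := by omega
        rw [this, pow_mul]
        rw [← mul_pow, ← mul_pow, ← mul_pow]
        congr 1
        rw [mul_pow, pow_succ]
        ring
    _ ≤ _ := by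
        exact mul_le_mul_of_nonneg_left
          (pow_le_pow_right₀ hj1 (Nat.mul_le_mul_right _ (by omega))) (by positivity)
end
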